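/- arXiv:2307.04222 — 7 statements merged into one kernel-verified Lean document; each statement's English description precedes it below -/
import Mathlib

section
/- Let n be a positive integer, let R, R', r ∈ [0,1] with Rn, R'n, rn integers, let G ∈ GF(2)^{(R+R')n × n} be partitioned as G = [G_M; G_W] with G_M ∈ GF(2)^{Rn×n} and G_W ∈ GF(2)^{R'n×n}, and let S ⊆ {1,…,n} with |S| = rn. Let M be uniformly distributed on {0,1}^{Rn}, let W be uniformly distributed on {0,1}^{R'n} and independent of M, and let Z = M·G_M(S) + W·G_W(S) ∈ GF(2)^{rn}. Then the mutual information (in bits) between M and Z equals rank(G(S)) − rank(G_W(S)), where ranks are over GF(2). -/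
open Finset
open scoped Classical

/-- Base-2 mutual information of a finite joint distribution `P` on `M × Z`
(marginals are computed from the joint). -/
noncomputable def mutualInfo {M Z : Type*} [Fintype M] [Fintype Z]
    (P : M → Z → ℝ) : ℝ :=
  ∑ m, ∑ z, P m z * Real.logb 2 (P m z / ((∑ z', P m z') * (∑ m', P m' z)))

/-- Every nonempty fiber of `v ↦ v ᵥ* B` over a finite field `K` has `|K| ^ (|ι| - rank B)`
elements. -/
theorem card_vecMul_fiber_mul {K ι κ : Type*} [Field K] [Fintype K] [DecidableEq K]
    [Fintype ι] [DecidableEq ι] [Fintype κ]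
    (B : Matrix ι κ K) (w₀ : ι → K) :
    #{w : ι → K | Matrix.vecMul w B = Matrix.vecMul w₀ B} * Fintype.card K ^ B.rank =
      Fintype.card K ^ Fintype.card ι := by
  have hfiber : #{w : ι → K | Matrix.vecMul w B = Matrix.vecMul w₀ B} =
      Nat.card (LinearMap.ker B.vecMulLinear) := by
    rw [Nat.card_eq_fintype_card, Fintype.card_subtype]
    refine Finset.card_bij (fun w _ => w - w₀) ?_ ?_ ?_
    · intro w hw
      simpa [Matrix.sub_vecMul, sub_eq_zero] using hw
    · intro w _ w' _ h
      exact sub_left_injective h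
    · intro w hw
      refine ⟨w + w₀, ?_, add_sub_cancel_right w w₀⟩
      simpa [Matrix.add_vecMul] using hw
  have hrank : B.rank = Module.finrank K (LinearMap.range B.vecMulLinear) := by
    rw [← Matrix.rank_transpose, Matrix.rank, Matrix.mulVecLin_transpose]
  rw [hfiber, Module.natCard_eq_pow_finrank (K := K), Nat.card_eq_fintype_card, ← pow_add, hrank,
    add_comm, LinearMap.finrank_range_add_finrank_ker, Module.finrank_fintype_fun_eq_card]

/-- If the joint distribution `P` has total mass one and its density with respect to the product
of its marginals is constantly `2 ^ t` on its support, then the mutual information is `t`. -/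
theorem mutualInfo_eq_of_density {M Z : Type*} [Fintype M] [Fintype Z] (P : M → Z → ℝ) (t : ℝ)
    (hone : ∑ m, ∑ z, P m z = 1)
    (hP : ∀ m z, P m z ≠ 0 → P m z / ((∑ z', P m z') * (∑ m', P m' z)) = 2 ^ t) :
    mutualInfo P = t := by
  have h : ∀ m z, P m z * Real.logb 2 (P m z / ((∑ z', P m z') * (∑ m', P m' z))) =
      P m z * t := by
    intro m z
    by_cases h0 : P m z = 0
    · simp [h0]
    · rw [hP m z h0, Real.logb_rpow (by norm_num) (by norm_num)]
  simp only [mutualInfo, h, ← Finset.sum_mul, hone, one_mul]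

/-- The mutual information between a uniform message `M` and the observation `M A + W B`, where
`W` is uniform and independent of `M`. -/
theorem mutualInfo_vecMul_add_vecMul {a b : ℕ} {κ : Type*} [Fintype κ]
    (A : Matrix (Fin a) κ (ZMod 2)) (B : Matrix (Fin b) κ (ZMod 2)) :
    mutualInfo (fun (m : Fin a → ZMod 2) (z : κ → ZMod 2) =>
      (#{w : Fin b → ZMod 2 | Matrix.vecMul m A + Matrix.vecMul w B = z} : ℝ) /
        ((2 : ℝ) ^ a * (2 : ℝ) ^ b)) =
      ((Matrix.fromRows A B).rank : ℝ) - (B.rank : ℝ) := by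
  have hrow : ∀ m : Fin a → ZMod 2, ∑ z : κ → ZMod 2,
      (#{w : Fin b → ZMod 2 | Matrix.vecMul m A + Matrix.vecMul w B = z} : ℝ) /
        ((2 : ℝ) ^ a * (2 : ℝ) ^ b) = ((2 : ℝ) ^ a)⁻¹ := by
    intro m
    rw [← Finset.sum_div, ← Nat.cast_sum, ← Finset.card_eq_sum_card_fiberwise (by simp)]
    simp [ZMod.card]
    field_simp
  have hcol : ∀ z : κ → ZMod 2, ∑ m : Fin a → ZMod 2,
      (#{w : Fin b → ZMod 2 | Matrix.vecMul m A + Matrix.vecMul w B = z} : ℝ) /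
        ((2 : ℝ) ^ a * (2 : ℝ) ^ b) =
      (#{v : Fin a ⊕ Fin b → ZMod 2 | Matrix.vecMul v (Matrix.fromRows A B) = z} : ℝ) /
        ((2 : ℝ) ^ a * (2 : ℝ) ^ b) := by
    intro z
    rw [← Finset.sum_div, ← Nat.cast_sum]
    congr 2
    simp only [Finset.card_filter]
    rw [← Fintype.sum_prod_type', ← (Equiv.sumArrowEquivProdArrow _ _ _).sum_comp]
    simp only [Matrix.vecMul_fromRows, Equiv.sumArrowEquivProdArrow, Equiv.coe_fn_mk]
    congr!
  apply mutualInfo_eq_of_density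
  · simp only [hrow]
    simp [ZMod.card]
  · intro m z h0
    rw [hrow, hcol]
    obtain ⟨w₀, hw₀⟩ : ∃ w₀ : Fin b → ZMod 2, Matrix.vecMul m A + Matrix.vecMul w₀ B = z := by
      by_contra! hne
      exact h0 (by simp [hne])
    have hB : #{w : Fin b → ZMod 2 | Matrix.vecMul m A + Matrix.vecMul w B = z} * 2 ^ B.rank =
        2 ^ b := by
      simpa [← hw₀, ZMod.card] using card_vecMul_fiber_mul B w₀
    have hC : #{v : Fin a ⊕ Fin b → ZMod 2 | Matrix.vecMul v (Matrix.fromRows A B) = z} *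
        2 ^ (Matrix.fromRows A B).rank = 2 ^ (a + b) := by
      have := card_vecMul_fiber_mul (Matrix.fromRows A B) (Sum.elim m w₀)
      rw [Matrix.sumElim_vecMul_fromRows, hw₀] at this
      simpa [ZMod.card] using this
    have hB' : (#{w : Fin b → ZMod 2 | Matrix.vecMul m A + Matrix.vecMul w B = z} : ℝ) =
        2 ^ b / 2 ^ B.rank := by
      rw [eq_div_iff (by positivity)]
      exact_mod_cast hB
    have hC' : (#{v : Fin a ⊕ Fin b → ZMod 2 | Matrix.vecMul v (Matrix.fromRows A B) = z} : ℝ) =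
        2 ^ a * 2 ^ b / 2 ^ (Matrix.fromRows A B).rank := by
      rw [eq_div_iff (by positivity), ← pow_add]
      exact_mod_cast hC
    rw [hB', hC', Real.rpow_sub (by norm_num), Real.rpow_natCast, Real.rpow_natCast]
    field_simp

/-- For a linear code with generator matrix `G = [G_M; G_W]`, message `M` uniform on
`{0,1}^{Rn}` and key `W` uniform on `{0,1}^{R'n}` independent of `M`, the mutual
information between `M` and `Z = M·G_M(S) + W·G_W(S)` equals
`rank(G(S)) − rank(G_W(S))`. -/
theorem mutual_info_eq_rank_difference
    (n : ℕ) (hn : 0 < n) (R R' r : ℝ)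
    (hR0 : 0 ≤ R) (hR1 : R ≤ 1) (hR'0 : 0 ≤ R') (hR'1 : R' ≤ 1)
    (hr0 : 0 ≤ r) (hr1 : r ≤ 1)
    (a b s : ℕ) (ha : (a : ℝ) = R * n) (hb : (b : ℝ) = R' * n) (hs : (s : ℝ) = r * n)
    (G : Matrix (Fin a ⊕ Fin b) (Fin n) (ZMod 2))
    (S : Finset (Fin n)) (hS : S.card = s) :
    mutualInfo (fun (m : Fin a → ZMod 2) (z : {i : Fin n // i ∈ S} → ZMod 2) =>
      ((Finset.univ.filter (fun w : Fin b → ZMod 2 =>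
          Matrix.vecMul m (G.submatrix Sum.inl (fun i : {i : Fin n // i ∈ S} => i.val))
            + Matrix.vecMul w (G.submatrix Sum.inr (fun i : {i : Fin n // i ∈ S} => i.val))
          = z)).card : ℝ) / ((2 : ℝ) ^ a * (2 : ℝ) ^ b)) =
    ((G.submatrix id (fun i : {i : Fin n // i ∈ S} => i.val)).rank : ℝ)
      - ((G.submatrix Sum.inr (fun i : {i : Fin n // i ∈ S} => i.val)).rank : ℝ) := by
  have hG : G.submatrix id (fun i : {i : Fin n // i ∈ S} => i.val) =
      Matrix.fromRows (G.submatrix Sum.inl (fun i : {i : Fin n // i ∈ S} => i.val))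
        (G.submatrix Sum.inr (fun i : {i : Fin n // i ∈ S} => i.val)) := by
    ext (i | i) j <;> rfl
  rw [hG]
  convert mutualInfo_vecMul_add_vecMul
    (G.submatrix Sum.inl (fun i : {i : Fin n // i ∈ S} => i.val))
    (G.submatrix Sum.inr (fun i : {i : Fin n // i ∈ S} => i.val))
end

section
/- Let n be a positive integer, let R, R', r ∈ [0,1] with Rn, R'n, rn integers, and let C_n be an [n,Rn,R'n] linear code over GF(2) whose generator matrix G ∈ GF(2)^{(R+R')n × n} has full rank (R+R')n. If R + R' ≤ r, then there exists a set S ⊆ {1,…,n} with |S| = rn such that, with M uniform on {0,1}^{Rn} and W uniform on {0,1}^{R'n} independent of M, the mutual information (in bits) between M and Z = x(M,W,S) equals Rn; in particular the semantic leakage satisfies Sem(C_n) ≥ Rn. -/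
open Finset
open scoped Classical

/-- Semantic leakage of a stochastic code with encoder `x : M → W → {0,1}ⁿ` against an
adversary reading `s` coordinates: the supremum, over message distributions `PM` and
coordinate sets `S` of size `s`, of the mutual information between `M ~ PM` and the
restriction of the codeword (with key `W` uniform, independent of `M`) to `S`. -/
noncomputable def semLeak {n : ℕ} {M W : Type*} [Fintype M] [Fintype W]
    (s : ℕ) (x : M → W → Fin n → ZMod 2) : ℝ :=
  sSup { I : ℝ | ∃ (PM : M → ℝ) (S : Finset (Fin n)),
    (∀ m, 0 ≤ PM m) ∧ (∑ m, PM m = 1) ∧ S.card = s ∧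
    I = mutualInfo (fun m (z : {i : Fin n // i ∈ S} → ZMod 2) =>
      PM m * (((Finset.univ.filter (fun w : W =>
        (fun i : {i : Fin n // i ∈ S} => x m w i.val) = z)).card : ℝ)
        / (Fintype.card W : ℝ))) }

theorem mutualInfo_le_of_nonneg {M Z : Type*} [Fintype M] [Fintype Z] (P : M → Z → ℝ)
    (hP : ∀ m z, 0 ≤ P m z) :
    mutualInfo P ≤ (Fintype.card M : ℝ) * (Fintype.card Z : ℝ) / Real.log 2 := by
  have hterm : ∀ m z, P m z * Real.logb 2 (P m z / ((∑ z', P m z') * (∑ m', P m' z)))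
      ≤ 1 / Real.log 2 := by
    intro m z
    have hlog : 0 < Real.log 2 := Real.log_pos one_lt_two
    rcases (hP m z).eq_or_lt with h | h
    · rw [← h, zero_mul]
      positivity
    have h1 : P m z ≤ ∑ z', P m z' :=
      Finset.single_le_sum (f := fun z' => P m z') (fun z' _ => hP m z') (Finset.mem_univ z)
    have h2 : P m z ≤ ∑ m', P m' z :=
      Finset.single_le_sum (f := fun m' => P m' z) (fun m' _ => hP m' z) (Finset.mem_univ m)
    set α := ∑ z', P m z'
    set β := ∑ m', P m' z
    set p := P m z
    have hα : 0 < α := h.trans_le h1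
    have hβ : 0 < β := h.trans_le h2
    have hq : p / (α * β) ≤ 1 / p := by
      rw [div_le_div_iff₀ (by positivity) h, one_mul]
      exact mul_le_mul h1 h2 h.le hα.le
    have hl : Real.log (p / (α * β)) ≤ 1 / p :=
      (Real.log_le_sub_one_of_pos (by positivity)).trans (by linarith)
    rw [Real.logb, ← mul_div_assoc]
    gcongr
    calc p * Real.log (p / (α * β)) ≤ p * (1 / p) := by gcongr
      _ = 1 := by field_simp
  calc mutualInfo P ≤ ∑ _m : M, ∑ _z : Z, 1 / Real.log 2 :=
        Finset.sum_le_sum fun m _ => Finset.sum_le_sum fun z _ => hterm m z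
    _ = _ := by
        simp only [Finset.sum_const, Finset.card_univ, nsmul_eq_mul]
        ring

/-- An injective deterministic function of a uniform message and key reveals the message. -/
theorem mutualInfo_eq_logb_card_of_injective {M W Z : Type*} [Fintype M] [Fintype W] [Fintype Z]
    [Nonempty M] [Nonempty W] [DecidableEq Z] (f : M → W → Z)
    (hf : ∀ m w m' w', f m w = f m' w' → m = m' ∧ w = w') :
    mutualInfo (fun m z => ((Finset.univ.filter (fun w : W => f m w = z)).card : ℝ)
      / ((Fintype.card M : ℝ) * (Fintype.card W : ℝ))) = Real.logb 2 (Fintype.card M) := by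
  set P : M → Z → ℝ := fun m z => ((Finset.univ.filter (fun w : W => f m w = z)).card : ℝ)
      / ((Fintype.card M : ℝ) * (Fintype.card W : ℝ)) with hP
  have hM : (Fintype.card M : ℝ) ≠ 0 := by simp
  have hW : (Fintype.card W : ℝ) ≠ 0 := by simp
  have hrow : ∀ m, ∑ z, P m z = 1 / (Fintype.card M : ℝ) := by
    intro m
    have hcard : ∑ z, (Finset.univ.filter (fun w : W => f m w = z)).card = Fintype.card W :=
      (Finset.card_eq_sum_card_fiberwise (s := Finset.univ) (t := Finset.univ) (f := f m)
        (fun _ _ => by simp)).symm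
    simp only [hP]
    rw [← Finset.sum_div, ← Nat.cast_sum, hcard]
    field_simp
  have hcol : ∀ m z, P m z ≠ 0 → ∑ m', P m' z = P m z := by
    intro m z h
    refine Finset.sum_eq_single m (fun m' _ hne => ?_) (by simp)
    obtain ⟨w, hw⟩ : ∃ w, f m w = z := by
      by_contra! hc
      exact h (by simp [hP, hc])
    have : ∀ w', f m' w' ≠ z := fun w' hw' => hne (hf _ _ _ _ (hw'.trans hw.symm)).1
    simp [hP, this]
  have hterm : ∀ m z, P m z * Real.logb 2 (P m z / ((∑ z', P m z') * (∑ m', P m' z)))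
      = P m z * Real.logb 2 (Fintype.card M) := by
    intro m z
    by_cases h : P m z = 0
    · simp [h]
    rw [hrow, hcol m z h]
    congr 2
    field_simp
  calc mutualInfo P = ∑ m, ∑ z, P m z * Real.logb 2 (Fintype.card M) :=
        Finset.sum_congr rfl fun m _ => Finset.sum_congr rfl fun z _ => hterm m z
    _ = Real.logb 2 (Fintype.card M) := by
        simp only [← Finset.sum_mul, hrow, Finset.sum_const, Finset.card_univ, nsmul_eq_mul]
        field_simp

/-- A matrix of full row rank stays injective on row vectors after restriction to a suitable
set of columns of any prescribed size that is at least the rank. -/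
theorem Matrix.exists_card_eq_vecMul_restrict_injective {ι κ K : Type*} [Fintype ι] [Fintype κ]
    [Field K] (G : Matrix ι κ K) (hG : G.rank = Fintype.card ι) {s : ℕ}
    (hs : Fintype.card ι ≤ s) (hsκ : s ≤ Fintype.card κ) :
    ∃ S : Finset κ, S.card = s ∧
      ∀ u v : ι → K, (∀ i ∈ S, Matrix.vecMul u G i = Matrix.vecMul v G i) → u = v := by
  obtain ⟨τ, c, hc, hspan, hli⟩ := exists_linearIndependent' K G.col
  have : Finite τ := Finite.of_injective c hc
  have := Fintype.ofFinite τ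
  have hfin : Module.finrank K (Submodule.span K (Set.range G.col)) = Fintype.card ι := by
    rw [← hG, Matrix.rank_eq_finrank_span_cols]
  have hcard : Fintype.card τ = Fintype.card ι := by
    rw [← hfin, ← hspan, finrank_span_eq_card hli]
  have htop : Submodule.span K (Set.range (G.col ∘ c)) = ⊤ := by
    apply Submodule.eq_top_of_finrank_eq
    rw [hspan, hfin, Module.finrank_fintype_fun_eq_card]
  obtain ⟨S, hsub, hS⟩ := Finset.exists_superset_card_eq
    (s := Finset.univ.map ⟨c, hc⟩) (n := s) (by simpa [hcard] using hs) hsκ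
  refine ⟨S, hS, fun u v h => ?_⟩
  have hzero : ∀ x : ι → K, (u - v) ⬝ᵥ x = 0 := by
    intro x
    have hx : x ∈ Submodule.span K (Set.range (G.col ∘ c)) := htop ▸ Submodule.mem_top
    induction hx using Submodule.span_induction with
    | mem x hx =>
      obtain ⟨t, rfl⟩ := hx
      have := h (c t) (hsub (by simp))
      rw [sub_dotProduct, sub_eq_zero]
      exact this
    | zero => simp
    | add x y _ _ hx hy => rw [dotProduct_add, hx, hy, add_zero]
    | smul k x _ hx => rw [dotProduct_smul, hx, smul_zero]
  exact sub_eq_zero.mp (dotProduct_eq_zero _ hzero)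

theorem bddAbove_semLeak {n : ℕ} {M W : Type*} [Fintype M] [Fintype W]
    (s : ℕ) (x : M → W → Fin n → ZMod 2) :
    BddAbove { I : ℝ | ∃ (PM : M → ℝ) (S : Finset (Fin n)),
      (∀ m, 0 ≤ PM m) ∧ (∑ m, PM m = 1) ∧ S.card = s ∧
      I = mutualInfo (fun m (z : {i : Fin n // i ∈ S} → ZMod 2) =>
        PM m * (((Finset.univ.filter (fun w : W =>
          (fun i : {i : Fin n // i ∈ S} => x m w i.val) = z)).card : ℝ)
          / (Fintype.card W : ℝ))) } := by
  refine ⟨(Fintype.card M : ℝ) * (2 : ℝ) ^ s / Real.log 2, ?_⟩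
  rintro I ⟨PM, S, hPM, -, hS, rfl⟩
  refine (mutualInfo_le_of_nonneg _ fun m z => mul_nonneg (hPM m) (by positivity)).trans_eq ?_
  simp [hS]

/-- If an `[n,Rn,R'n]` linear code has a full-rank generator matrix and `R + R' ≤ r`,
then some read set `S` of size `rn` yields mutual information exactly `Rn` (for `M`
uniform and `W` uniform independent of `M`); in particular `Sem(C_n) ≥ Rn`. -/
theorem full_read_leakage_of_low_rate
    (n : ℕ) (hn : 0 < n) (R R' r : ℝ)
    (hR0 : 0 ≤ R) (hR1 : R ≤ 1) (hR'0 : 0 ≤ R') (hR'1 : R' ≤ 1)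
    (hr0 : 0 ≤ r) (hr1 : r ≤ 1)
    (a b s : ℕ) (ha : (a : ℝ) = R * n) (hb : (b : ℝ) = R' * n) (hs : (s : ℝ) = r * n)
    (G : Matrix (Fin a ⊕ Fin b) (Fin n) (ZMod 2))
    (hfull : G.rank = a + b)
    (hle : R + R' ≤ r) :
    ∃ S : Finset (Fin n), S.card = s ∧
      mutualInfo (fun (m : Fin a → ZMod 2) (z : {i : Fin n // i ∈ S} → ZMod 2) =>
        ((Finset.univ.filter (fun w : Fin b → ZMod 2 =>
            (fun i : {i : Fin n // i ∈ S} => Matrix.vecMul (Sum.elim m w) G i.val) = z)).card : ℝ)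
          / ((2 : ℝ) ^ a * (2 : ℝ) ^ b)) = (a : ℝ)
    ∧ (a : ℝ) ≤ semLeak s (fun (m : Fin a → ZMod 2) (w : Fin b → ZMod 2) =>
        Matrix.vecMul (Sum.elim m w) G) := by
  have hn' : (0 : ℝ) < n := by exact_mod_cast hn
  have habs : a + b ≤ s := by
    have : (a : ℝ) + b ≤ s := by
      rw [ha, hb, hs, ← add_mul]
      gcongr
    exact_mod_cast this
  have hsn : s ≤ n := by
    have : (s : ℝ) ≤ n := by
      rw [hs]
      exact mul_le_of_le_one_left hn'.le hr1
    exact_mod_cast this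
  obtain ⟨S, hS, hinj⟩ := G.exists_card_eq_vecMul_restrict_injective (s := s)
    (by simpa using hfull) (by simpa using habs) (by simpa using hsn)
  have hMI := mutualInfo_eq_logb_card_of_injective
    (fun (m : Fin a → ZMod 2) (w : Fin b → ZMod 2) (i : {i : Fin n // i ∈ S}) =>
      Matrix.vecMul (Sum.elim m w) G i.val) (fun m w m' w' h => by
        have := hinj _ _ fun i hi => congrFun h ⟨i, hi⟩
        exact ⟨funext fun i => congrFun this (Sum.inl i),
          funext fun i => congrFun this (Sum.inr i)⟩)
  have hlog : Real.logb 2 (Fintype.card (Fin a → ZMod 2)) = a := by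
    simp [Real.logb_pow]
  rw [hlog] at hMI
  refine ⟨S, hS, ?_, ?_⟩
  · rw [← hMI]
    simp
  · refine le_csSup (bddAbove_semLeak s _)
      ⟨fun _ => 1 / Fintype.card (Fin a → ZMod 2), S, fun _ => by positivity, by simp, hS, ?_⟩
    rw [← hMI]
    congr 1
    funext m z
    rw [div_mul_div_comm, one_mul]
end

section
/- Let p = 0 and r ∈ (0,1], let R > max{1−2r, 0} and R' ∈ [0, 1−R]. There exists n₀ such that for all n ≥ n₀ with Rn, R'n, rn integers, every [n,Rn,R'n] linear code C_n over GF(2) satisfies at least one of the following: (i) the semantic leakage satisfies Sem(C_n) ≥ 1; or (ii) for every decoding function φ : {0,1}^n → {0,1}^{Rn}, there exists a message m ∈ {0,1}^{Rn} such that, with W uniform on {0,1}^{R'n}, the probability that φ(x(m,W)) ≠ m is at least 1/2. -/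
open Finset
open scoped Classical

/-- A crude bound on the mutual information of a nonnegative array. -/
lemma mutualInfo_le {M Z : Type*} [Fintype M] [Fintype Z] (P : M → Z → ℝ)
    (hP : ∀ m z, 0 ≤ P m z) :
    mutualInfo P ≤ Fintype.card M * (Fintype.card Z * (Real.log 2)⁻¹) := by
  have hlog : 0 < Real.log 2 := Real.log_pos (by norm_num)
  have term : ∀ m z, P m z * Real.logb 2 (P m z / ((∑ z', P m z') * (∑ m', P m' z)))
      ≤ (Real.log 2)⁻¹ := by
    intro m z
    have h1 : P m z ≤ ∑ z', P m z' :=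
      Finset.single_le_sum (f := fun z' => P m z') (fun z' _ => hP m z') (Finset.mem_univ z)
    have h2 : P m z ≤ ∑ m', P m' z :=
      Finset.single_le_sum (f := fun m' => P m' z) (fun m' _ => hP m' z) (Finset.mem_univ m)
    rcases (hP m z).eq_or_lt with h0 | hpos
    · rw [← h0, zero_mul]
      positivity
    · have hA : 0 < ∑ z', P m z' := hpos.trans_le h1
      have hB : 0 < ∑ m', P m' z := hpos.trans_le h2
      have h3 : Real.log (P m z / ((∑ z', P m z') * (∑ m', P m' z)))
          ≤ P m z / ((∑ z', P m z') * (∑ m', P m' z)) :=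
        Real.log_le_self (by positivity)
      have h4 : P m z * Real.log (P m z / ((∑ z', P m z') * (∑ m', P m' z))) ≤ 1 := by
        calc _ ≤ P m z * (P m z / ((∑ z', P m z') * (∑ m', P m' z))) := by gcongr
          _ = (P m z * P m z) / ((∑ z', P m z') * (∑ m', P m' z)) := by ring
          _ ≤ 1 := by
            rw [div_le_one (by positivity)]
            gcongr
      rw [Real.logb, ← mul_div_assoc, div_eq_mul_inv]
      exact mul_le_of_le_one_left (by positivity) h4
  calc mutualInfo P ≤ ∑ _m : M, ∑ _z : Z, (Real.log 2)⁻¹ :=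
        Finset.sum_le_sum fun m _ => Finset.sum_le_sum fun z _ => term m z
    _ = _ := by simp

/-- If two messages never produce the same restriction to some set `S` of `s` coordinates,
then the semantic leakage is at least one bit. -/
lemma one_le_semLeak_of_separated {n : ℕ} {M W : Type*} [Fintype M] [Fintype W] [Nonempty W]
    {s : ℕ} (x : M → W → Fin n → ZMod 2) (S : Finset (Fin n)) (hS : S.card = s)
    (m₀ m₁ : M) (hne : m₀ ≠ m₁)
    (hsep : ∀ w w', (fun i : {i : Fin n // i ∈ S} => x m₀ w i.val) ≠
      (fun i : {i : Fin n // i ∈ S} => x m₁ w' i.val)) :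
    1 ≤ semLeak s x := by
  have hW : (0 : ℝ) < Fintype.card W := by exact_mod_cast Fintype.card_pos
  unfold semLeak
  apply le_csSup
  · refine ⟨Fintype.card M * ((2 : ℝ) ^ s * (Real.log 2)⁻¹), ?_⟩
    rintro I ⟨PM, S', hPM, -, hS', rfl⟩
    refine (mutualInfo_le _ fun m z => mul_nonneg (hPM m) (by positivity)).trans_eq ?_
    simp [ZMod.card, hS']
  · set Q : M → ({i : Fin n // i ∈ S} → ZMod 2) → ℝ := fun m z =>
      ((Finset.univ.filter (fun w : W =>
        (fun i : {i : Fin n // i ∈ S} => x m w i.val) = z)).card : ℝ) / (Fintype.card W : ℝ)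
      with hQ
    have hQsum : ∀ m, ∑ z, Q m z = 1 := by
      intro m
      rw [hQ]
      simp only
      rw [← Finset.sum_div, div_eq_one_iff_eq hW.ne', ← Nat.cast_sum]
      congr 1
      have := Finset.card_eq_sum_card_fiberwise (s := (Finset.univ : Finset W))
        (t := Finset.univ) (f := fun w => (fun i : {i : Fin n // i ∈ S} => x m w i.val))
        (fun _ _ => by simp)
      rw [← Finset.card_univ, this]
    have hdisj : ∀ z, Q m₀ z = 0 ∨ Q m₁ z = 0 := by
      intro z
      by_contra! h
      obtain ⟨h0, h1⟩ := h
      have ex : ∀ m, Q m z ≠ 0 → ∃ w, (fun i : {i : Fin n // i ∈ S} => x m w i.val) = z := by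
        intro m hm
        by_contra! hc
        apply hm
        simp [hQ, Finset.filter_false_of_mem, hc]
      obtain ⟨w, hw⟩ := ex _ h0
      obtain ⟨w', hw'⟩ := ex _ h1
      exact hsep w w' (hw.trans hw'.symm)
    set PM : M → ℝ := fun m => if m = m₀ ∨ m = m₁ then 1 / 2 else 0 with hPM
    have hpair : ∀ f : M → ℝ, ∑ m, PM m * f m = 1 / 2 * f m₀ + 1 / 2 * f m₁ := by
      intro f
      rw [← Finset.sum_subset (Finset.subset_univ ({m₀, m₁} : Finset M)), Finset.sum_pair hne]
      · simp [hPM]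
      · intro m _ hm
        simp only [Finset.mem_insert, Finset.mem_singleton] at hm
        simp [hPM, hm]
    refine ⟨PM, S, ?_, ?_, hS, ?_⟩
    · intro m
      simp only [hPM]
      split_ifs <;> norm_num
    · have := hpair fun _ => 1
      simp only [mul_one] at this
      rw [this]
      norm_num
    · change 1 = mutualInfo fun m z => PM m * Q m z
      have term : ∀ m z, PM m * Q m z * Real.logb 2 (PM m * Q m z /
          ((∑ z', PM m * Q m z') * (∑ m', PM m' * Q m' z))) = PM m * Q m z := by
        intro m z
        by_cases h : PM m * Q m z = 0
        · simp [h]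
        · have hm : m = m₀ ∨ m = m₁ := by
            by_contra hc
            exact h (by simp [hPM, hc])
          have hq : Q m z ≠ 0 := right_ne_zero_of_mul h
          have hpm : PM m = 1 / 2 := by simp [hPM, hm]
          have hmarg : ∑ m', PM m' * Q m' z = 1 / 2 * Q m z := by
            rw [hpair fun m' => Q m' z]
            rcases hm with rfl | rfl
            · rw [(hdisj z).resolve_left hq]
              ring
            · rw [(hdisj z).resolve_right hq]
              ring
          rw [hmarg, ← Finset.mul_sum, hQsum, hpm]
          have : (1 / 2 * Q m z / (1 / 2 * 1 * (1 / 2 * Q m z)) : ℝ) = 2 := by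
            field_simp
          rw [this, Real.logb_self_eq_one (by norm_num), mul_one]
      unfold mutualInfo
      simp only [term]
      simp only [← Finset.mul_sum, hQsum]
      rw [hpair fun _ => 1]
      norm_num

/-- A linear functional over `GF(2)` is nonzero on at most half of the space. -/
lemma two_mul_card_filter_ne_zero_le {V : Type*} [AddCommGroup V] [Module (ZMod 2) V] [Fintype V]
    (f : V →ₗ[ZMod 2] ZMod 2) :
    2 * (Finset.univ.filter fun v => f v ≠ 0).card ≤ Fintype.card V := by
  have hsplit := Finset.card_filter_add_card_filter_not (s := (Finset.univ : Finset V))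
    (fun v => f v ≠ 0)
  rw [Finset.card_univ] at hsplit
  suffices h : (Finset.univ.filter fun v => f v ≠ 0).card ≤
      (Finset.univ.filter fun v => ¬ f v ≠ 0).card by omega
  by_cases h : ∃ v₀, f v₀ ≠ 0
  · obtain ⟨v₀, hv₀⟩ := h
    refine Finset.card_le_card_of_injOn (fun v => v + v₀) ?_ (add_left_injective v₀).injOn
    intro v hv
    have key : ∀ p q : ZMod 2, p ≠ 0 → q ≠ 0 → p + q = 0 := by decide
    simp only [Finset.coe_filter, Finset.mem_univ, true_and, Set.mem_ofPred_eq, not_not,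
      map_add] at hv ⊢
    exact key _ _ hv hv₀
  · push Not at h
    simp [h]

/-- Averaging step of the Plotkin bound: a binary linear code with more than `s + 1` codewords,
all supported on a set of at most `2 * s` coordinates, has a nonzero word of weight at most `s`. -/
lemma exists_card_support_le_of_card_lt {n s : ℕ} {V : Type*} [AddCommGroup V]
    [Module (ZMod 2) V] [Fintype V] (σ : V →ₗ[ZMod 2] (Fin n → ZMod 2)) (T : Finset (Fin n))
    (hT : T.card ≤ 2 * s) (hσ : ∀ v, ∀ i ∉ T, σ v i = 0) (hcard : s + 1 < Fintype.card V) :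
    ∃ v, v ≠ 0 ∧ (Finset.univ.filter fun i => σ v i ≠ 0).card ≤ s := by
  by_contra! h
  have hlow : (Fintype.card V - 1) * (s + 1) ≤
      ∑ v, (Finset.univ.filter fun i => σ v i ≠ 0).card := by
    calc (Fintype.card V - 1) * (s + 1) = ∑ _v ∈ Finset.univ.erase (0 : V), (s + 1) := by
          simp [Finset.card_erase_of_mem]
      _ ≤ ∑ v ∈ Finset.univ.erase (0 : V), (Finset.univ.filter fun i => σ v i ≠ 0).card :=
          Finset.sum_le_sum fun v hv => h v (Finset.ne_of_mem_erase hv)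
      _ ≤ _ := Finset.sum_le_sum_of_subset (Finset.erase_subset _ _)
  have hup : 2 * ∑ v, (Finset.univ.filter fun i => σ v i ≠ 0).card ≤
      T.card * Fintype.card V := by
    have hcount : ∑ v, (Finset.univ.filter fun i => σ v i ≠ 0).card =
        ∑ i ∈ T, (Finset.univ.filter fun v => σ v i ≠ 0).card := by
      have h1 : ∀ v, (Finset.univ.filter fun i => σ v i ≠ 0) = T.filter fun i => σ v i ≠ 0 := by
        intro v
        ext i
        simp only [Finset.mem_filter, Finset.mem_univ, true_and]
        exact ⟨fun hi => ⟨by by_contra hiT; exact hi (hσ v i hiT), hi⟩, fun hi => hi.2⟩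
      simp only [h1]
      exact Finset.sum_card_bipartiteAbove_eq_sum_card_bipartiteBelow (fun v i => σ v i ≠ 0)
    rw [hcount, Finset.mul_sum, ← smul_eq_mul T.card, ← Finset.sum_const]
    exact Finset.sum_le_sum fun i _ =>
      two_mul_card_filter_ne_zero_le ((LinearMap.proj i).comp σ)
  obtain ⟨k, hk⟩ : ∃ k, Fintype.card V = k + 1 := ⟨Fintype.card V - 1, by omega⟩
  rw [hk] at hlow hup hcard
  rw [Nat.add_sub_cancel] at hlow
  have : T.card * (k + 1) ≤ 2 * s * (k + 1) := Nat.mul_le_mul_right _ hT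
  nlinarith

/-- Plotkin bound for binary linear codes, in the form obtained by shortening to `t`
coordinates. -/
lemma exists_card_support_le {n a s t c : ℕ}
    (σ : (Fin a → ZMod 2) →ₗ[ZMod 2] (Fin n → ZMod 2))
    (htn : t ≤ n) (hts : t ≤ 2 * s) (hc : n + c = a + t) (hs : s + 1 < 2 ^ c) :
    ∃ m, m ≠ 0 ∧ (Finset.univ.filter fun i => σ m i ≠ 0).card ≤ s := by
  obtain ⟨T, -, hTc⟩ := Finset.exists_subset_card_eq
    (s := (Finset.univ : Finset (Fin n))) (n := t) (by simpa using htn)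
  let ρ : (Fin n → ZMod 2) →ₗ[ZMod 2] ({i // i ∈ Tᶜ} → ZMod 2) :=
    LinearMap.funLeft (ZMod 2) (ZMod 2) Subtype.val
  let K := LinearMap.ker (ρ ∘ₗ σ)
  have hrank := LinearMap.finrank_range_add_finrank_ker (ρ ∘ₗ σ)
  have hle : Module.finrank (ZMod 2) (LinearMap.range (ρ ∘ₗ σ)) ≤ n - t := by
    refine (Submodule.finrank_le _).trans_eq ?_
    rw [Module.finrank_fintype_fun_eq_card, Fintype.card_coe, Finset.card_compl, hTc,
      Fintype.card_fin]
  have hfin : c ≤ Module.finrank (ZMod 2) K := by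
    rw [Module.finrank_fintype_fun_eq_card, Fintype.card_fin] at hrank
    change c ≤ Module.finrank (ZMod 2) (LinearMap.ker (ρ ∘ₗ σ))
    omega
  have hcardK : s + 1 < Fintype.card K := by
    rw [Module.card_eq_pow_finrank (K := ZMod 2), ZMod.card]
    exact hs.trans_le (Nat.pow_le_pow_right (by norm_num) hfin)
  obtain ⟨v, hv, hw⟩ := exists_card_support_le_of_card_lt (σ ∘ₗ K.subtype) T (hTc ▸ hts)
    (fun v i hi => congrFun (LinearMap.mem_ker.mp v.2) ⟨i, Finset.mem_compl.mpr hi⟩) hcardK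
  exact ⟨v, fun h => hv (Subtype.ext h), hw⟩

/-- If the message rows of `G` are independent modulo the span of the key rows, then every value
of the message syndrome is attained linearly by vectors with zero key syndrome. -/
lemma exists_syndrome_section {n a b : ℕ} (G : Matrix (Fin a ⊕ Fin b) (Fin n) (ZMod 2))
    (hG : ∀ m w, Matrix.vecMul (Sum.elim m w) G = 0 → m = 0) :
    ∃ σ : (Fin a → ZMod 2) →ₗ[ZMod 2] (Fin n → ZMod 2),
      ∀ m, Matrix.mulVec G (σ m) = Sum.elim m 0 := by
  let A : (Fin n → ZMod 2) →ₗ[ZMod 2] (Fin a → ZMod 2) := (G.submatrix Sum.inl id).mulVecLin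
  let B : (Fin n → ZMod 2) →ₗ[ZMod 2] (Fin b → ZMod 2) := (G.submatrix Sum.inr id).mulVecLin
  have hsurj : LinearMap.range (A ∘ₗ (LinearMap.ker B).subtype) = ⊤ := by
    by_contra hne
    obtain ⟨f, hf, hfA⟩ := Submodule.exists_le_ker_of_lt_top _ (lt_top_iff_ne_top.mpr hne)
    have hker : LinearMap.ker B ≤ LinearMap.ker (f ∘ₗ A) := fun v hv =>
      hfA ⟨⟨v, hv⟩, rfl⟩
    have hmem : f ∘ₗ A ∈ LinearMap.range B.dualMap := by
      rw [LinearMap.range_dualMap_eq_dualAnnihilator_ker, Submodule.mem_dualAnnihilator]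
      exact fun v hv => hker hv
    obtain ⟨g, hg⟩ := hmem
    let μ : Fin a → ZMod 2 := fun i => f (Pi.single i 1)
    let ω : Fin b → ZMod 2 := fun i => g (Pi.single i 1)
    have expand : ∀ {k : ℕ} (h : (Fin k → ZMod 2) →ₗ[ZMod 2] ZMod 2) (v : Fin k → ZMod 2),
        h v = ∑ i, h (Pi.single i 1) * v i := by
      intro k h v
      conv_lhs => rw [pi_eq_sum_univ' v]
      rw [map_sum]
      refine Finset.sum_congr rfl fun i _ => ?_
      rw [map_smul, smul_eq_mul, mul_comm]
    have hμ : μ = 0 := by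
      apply hG μ ω
      ext j
      have h1 : g (B (Pi.single j 1)) = f (A (Pi.single j 1)) :=
        LinearMap.congr_fun hg (Pi.single j 1)
      rw [expand g, expand f] at h1
      simp only [Matrix.vecMul, dotProduct, Fintype.sum_sum_type, Sum.elim_inl, Sum.elim_inr,
        Pi.zero_apply]
      have hA : ∀ i, A (Pi.single j 1) i = G (Sum.inl i) j := by
        intro i
        simp [A]
      have hB : ∀ i, B (Pi.single j 1) i = G (Sum.inr i) j := by
        intro i
        simp [B]
      simp only [hA, hB] at h1
      rw [show ∑ i, ω i * G (Sum.inr i) j = ∑ i, μ i * G (Sum.inl i) j from h1]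
      exact CharTwo.add_self_eq_zero _
    apply hf
    refine LinearMap.ext fun v => ?_
    rw [expand f]
    exact Finset.sum_eq_zero fun i _ => by
      rw [show f (Pi.single i 1) = 0 from congrFun hμ i, zero_mul]
  obtain ⟨τ, hτ⟩ := LinearMap.exists_rightInverse_of_surjective _ hsurj
  refine ⟨(LinearMap.ker B).subtype ∘ₗ τ, fun m => ?_⟩
  have hA : A (τ m : Fin n → ZMod 2) = m := LinearMap.congr_fun hτ m
  have hB : B (τ m : Fin n → ZMod 2) = 0 := (τ m).2
  ext i
  rcases i with i | i
  · exact congrFun hA i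
  · exact congrFun hB i

/-- If a nonzero message shares a codeword coset with the zero message, then every decoder errs
with probability at least one half on some message. -/
lemma exists_half_le_error {n a b : ℕ} (G : Matrix (Fin a ⊕ Fin b) (Fin n) (ZMod 2))
    (m₁ : Fin a → ZMod 2) (w₁ : Fin b → ZMod 2) (h : Matrix.vecMul (Sum.elim m₁ w₁) G = 0)
    (hm₁ : m₁ ≠ 0) (φ : (Fin n → ZMod 2) → (Fin a → ZMod 2)) :
    ∃ m : Fin a → ZMod 2, (1 / 2 : ℝ) ≤
      ((Finset.univ.filter (fun w : Fin b → ZMod 2 =>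
        φ (Matrix.vecMul (Sum.elim m w) G) ≠ m)).card : ℝ) / (2 : ℝ) ^ b := by
  have hshift : ∀ w, Matrix.vecMul (Sum.elim m₁ (w + w₁)) G =
      Matrix.vecMul (Sum.elim 0 w) G := by
    intro w
    have : (Sum.elim m₁ (w + w₁) : Fin a ⊕ Fin b → ZMod 2) =
        Sum.elim (0 : Fin a → ZMod 2) w + Sum.elim m₁ w₁ := by
      ext i
      rcases i with i | i <;> simp
    rw [this, Matrix.add_vecMul, h, add_zero]
  set E : (Fin a → ZMod 2) → Finset (Fin b → ZMod 2) := fun m =>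
    Finset.univ.filter fun w => φ (Matrix.vecMul (Sum.elim m w) G) ≠ m with hE
  have hcover : Finset.univ ⊆ E 0 ∪ (E m₁).image (fun w => w - w₁) := by
    intro w _
    by_cases hw : φ (Matrix.vecMul (Sum.elim 0 w) G) = 0
    · refine Finset.mem_union_right _ (Finset.mem_image.mpr ⟨w + w₁, ?_, by simp⟩)
      simp only [hE, Finset.mem_filter, Finset.mem_univ, true_and]
      rw [hshift, hw]
      exact hm₁.symm
    · exact Finset.mem_union_left _ (by simp [hE, hw])
  have hcard : 2 ^ b ≤ (E 0).card + (E m₁).card := by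
    have h1 := (Finset.card_le_card hcover).trans (Finset.card_union_le _ _)
    have h2 : ((E m₁).image (fun w => w - w₁)).card ≤ (E m₁).card := Finset.card_image_le
    have h3 : (Finset.univ : Finset (Fin b → ZMod 2)).card = 2 ^ b := by simp [ZMod.card]
    omega
  have hcardR : (2 : ℝ) ^ b ≤ (E 0).card + (E m₁).card := by exact_mod_cast hcard
  have hpos : (0 : ℝ) < 2 ^ b := by positivity
  rcases le_total ((2 : ℝ) ^ b) (2 * (E 0).card) with h0 | h0
  · exact ⟨0, by rw [le_div_iff₀ hpos]; linarith⟩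
  · exact ⟨m₁, by rw [le_div_iff₀ hpos]; linarith⟩

/-- A low-weight vector with zero key syndrome and nonzero message syndrome forces leakage. -/
lemma one_le_semLeak_of_syndrome {n a b s : ℕ} (G : Matrix (Fin a ⊕ Fin b) (Fin n) (ZMod 2))
    (hsn : s ≤ n) (u : Fin n → ZMod 2) (m : Fin a → ZMod 2) (hm : m ≠ 0)
    (hu : Matrix.mulVec G u = Sum.elim m 0)
    (hwt : (Finset.univ.filter fun i => u i ≠ 0).card ≤ s) :
    1 ≤ semLeak s (fun (m : Fin a → ZMod 2) (w : Fin b → ZMod 2) =>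
      Matrix.vecMul (Sum.elim m w) G) := by
  obtain ⟨S, hsub, hS⟩ := Finset.exists_superset_card_eq hwt (by simpa using hsn)
  obtain ⟨i, hi⟩ := Function.ne_iff.mp hm
  have hdot : ∀ (m' : Fin a → ZMod 2) (w : Fin b → ZMod 2),
      ∑ j, Matrix.vecMul (Sum.elim m' w) G j * u j = ∑ k, m' k * m k := by
    intro m' w
    change Matrix.vecMul (Sum.elim m' w) G ⬝ᵥ u = _
    rw [← Matrix.dotProduct_mulVec, hu]
    simp [dotProduct]
  refine one_le_semLeak_of_separated _ S hS 0 (Pi.single i 1) ?_ ?_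
  · intro h
    simpa using congrFun h i
  · intro w w' h
    have heq : ∑ j, Matrix.vecMul (Sum.elim 0 w) G j * u j =
        ∑ j, Matrix.vecMul (Sum.elim (Pi.single i 1) w') G j * u j := by
      refine Finset.sum_congr rfl fun j _ => ?_
      by_cases hj : u j = 0
      · simp [hj]
      · have hjS : j ∈ S := hsub (by simp [hj])
        rw [show Matrix.vecMul (Sum.elim 0 w) G j =
          Matrix.vecMul (Sum.elim (Pi.single i 1) w') G j from congrFun h ⟨j, hjS⟩]
    rw [hdot, hdot] at heq
    apply hi
    simpa [Pi.single_apply] using heq.symm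

/-- Exponentials eventually dominate `n + 1`. -/
lemma exists_forall_add_one_lt_two_pow {δ : ℝ} (hδ : 0 < δ) :
    ∃ n₀ : ℕ, ∀ n : ℕ, n₀ ≤ n → ∀ c : ℕ, δ * n ≤ c → n + 1 < 2 ^ c := by
  have hbase : 1 < (2 : ℝ) ^ δ := Real.one_lt_rpow (by norm_num) hδ
  have hlit := (isLittleO_coe_const_pow_of_one_lt (R := ℝ) hbase).def
    (show (0 : ℝ) < 1 / 3 by norm_num)
  obtain ⟨N, hN⟩ := Filter.eventually_atTop.mp hlit
  refine ⟨max N 1, fun n hn c hc => ?_⟩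
  have h1 := hN n (le_of_max_le_left hn)
  have hn1 : (1 : ℝ) ≤ n := by exact_mod_cast le_of_max_le_right hn
  rw [Real.norm_of_nonneg (by positivity), Real.norm_of_nonneg (by positivity),
    ← Real.rpow_mul_natCast (by norm_num)] at h1
  have h2 : (2 : ℝ) ^ (δ * n) ≤ 2 ^ c := by
    rw [← Real.rpow_natCast]
    exact Real.rpow_le_rpow_of_exponent_le (by norm_num) hc
  have h3 : (n : ℝ) + 1 < 2 ^ c := by linarith
  exact_mod_cast h3

/-- Theorem 1: for the noiseless (`p = 0`) type-II wiretap channel with read fraction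
`r ∈ (0,1]`, any `[n,Rn,R'n]` linear code with `R > max{1−2r,0}` and `R' ∈ [0,1−R]` has,
for `n` large enough, either semantic leakage at least `1`, or decoding error probability
at least `1/2` for some message under every decoder. -/
theorem linear_codes_fail
    (r : ℝ) (hr0 : 0 < r) (hr1 : r ≤ 1)
    (R R' : ℝ) (hR : max (1 - 2 * r) 0 < R) (hR'0 : 0 ≤ R') (hR'1 : R' ≤ 1 - R) :
    ∃ n₀ : ℕ, ∀ n : ℕ, n₀ ≤ n →
      ∀ a b s : ℕ, (a : ℝ) = R * n → (b : ℝ) = R' * n → (s : ℝ) = r * n →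
      ∀ G : Matrix (Fin a ⊕ Fin b) (Fin n) (ZMod 2),
        (1 ≤ semLeak s (fun (m : Fin a → ZMod 2) (w : Fin b → ZMod 2) =>
            Matrix.vecMul (Sum.elim m w) G))
        ∨ (∀ φ : (Fin n → ZMod 2) → (Fin a → ZMod 2),
            ∃ m : Fin a → ZMod 2,
              (1 / 2 : ℝ) ≤
                ((Finset.univ.filter (fun w : Fin b → ZMod 2 =>
                  φ (Matrix.vecMul (Sum.elim m w) G) ≠ m)).card : ℝ) / (2 : ℝ) ^ b) := by
  obtain ⟨hR1, hR0⟩ := max_lt_iff.mp hR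
  obtain ⟨n₀, hn₀⟩ := exists_forall_add_one_lt_two_pow (sub_pos.mpr hR)
  refine ⟨n₀, fun n hn a b s ha _ hs G => ?_⟩
  by_cases hG : ∀ m w, Matrix.vecMul (Sum.elim m w) G = 0 → m = 0
  · left
    obtain ⟨σ, hσ⟩ := exists_syndrome_section G hG
    have hn0 : (0 : ℝ) ≤ n := Nat.cast_nonneg n
    have hsn : s ≤ n := by
      have : (s : ℝ) ≤ n := by rw [hs]; exact mul_le_of_le_one_left hn0 hr1
      exact_mod_cast this
    have hc : ∃ c, n + c = a + min n (2 * s) ∧ (R - max (1 - 2 * r) 0) * n ≤ c := by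
      rcases le_total n (2 * s) with h | h
      · refine ⟨a, by rw [min_eq_left h, add_comm], ?_⟩
        rw [ha]
        gcongr
        linarith [le_max_right (1 - 2 * r) 0]
      · have hna : n ≤ a + 2 * s := by
          have : (n : ℝ) ≤ a + 2 * s := by
            rw [ha, hs]
            nlinarith
          exact_mod_cast this
        refine ⟨a + 2 * s - n, by rw [min_eq_right h]; omega, ?_⟩
        rw [Nat.cast_sub hna]
        push_cast
        rw [ha, hs]
        nlinarith [le_max_left (1 - 2 * r) 0]
    obtain ⟨c, hc, hδ⟩ := hc
    obtain ⟨m, hm, hwt⟩ := exists_card_support_le σ (min_le_left n (2 * s)) (min_le_right _ _) hc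
      ((Nat.succ_le_succ hsn).trans_lt (hn₀ n hn c hδ))
    exact one_le_semLeak_of_syndrome G hsn (σ m) m hm (hσ m) hwt
  · right
    push Not at hG
    obtain ⟨m₁, w₁, h, hm₁⟩ := hG
    exact exists_half_le_error G m₁ w₁ h hm₁
end

section
/- Let U and V be finite sets, let Q_U be a probability mass function on U, let Q_{V|U} be a channel (a conditional PMF from U to V), let Q_V(v) = Σ_u Q_U(u) Q_{V|U}(v|u), and let I(U;V) be the base-2 mutual information of the joint PMF Q_{U,V}(u,v) = Q_U(u)Q_{V|U}(v|u). Let R' > I(U;V). Then there exist γ₀ > 0 and γ₁ > 0 (depending only on Q_U, Q_{V|U} and R') such that for every even integer k ≥ 4 and all sufficiently large n with R'n an integer, the following holds. Let 𝒞_n = (U(1),…,U(2^{R'n})) be random codewords in U^n that are k-wise independent, each with marginal distribution Q_U^n (the n-fold product of Q_U), and let P_V^{(𝒞_n)}(v) = 2^{−R'n} Σ_{w=1}^{2^{R'n}} Q_{V|U}^n(v | U(w)) for v ∈ V^n, where Q_{V|U}^n is the n-fold memoryless extension. Then Pr[ D( P_V^{(𝒞_n)} ‖ Q_V^n ) > 2^{−γ₁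 n} ] ≤ 2^{(−kγ₀ + log₂|V|) n}. -/
open Finset
open scoped Classical

/-- Probability of event `E` on a finite space with mass function `μ`. -/
noncomputable def pr {Ω : Type*} [Fintype Ω] (μ : Ω → ℝ) (E : Ω → Prop) : ℝ :=
  ∑ ω ∈ Finset.univ.filter E, μ ω

/-- A family `X : W → Ω → α` of random variables is `k`-wise independent (under `μ`)
if every subfamily of size at most `k` is mutually independent. -/
def kWiseIndep {Ω W α : Type*} [Fintype Ω] (μ : Ω → ℝ) (X : W → Ω → α) (k : ℕ) : Prop :=
  ∀ S : Finset W, S.card ≤ k → ∀ f : W → α,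
    pr μ (fun ω => ∀ w ∈ S, X w ω = f w) = ∏ w ∈ S, pr μ (fun ω => X w ω = f w)

/-- Base-2 relative entropy `D(P‖Q)` on a finite set (terms with `P v = 0` vanish). -/
noncomputable def relEnt {V : Type*} [Fintype V] (P Q : V → ℝ) : ℝ :=
  ∑ v, P v * Real.logb 2 (P v / Q v)

lemma sum_mul_prod_of_kWiseIndep {Ω W α : Type*} [Fintype Ω] [Fintype α] [Nonempty α]
    {μ : Ω → ℝ} {X : W → Ω → α} {k : ℕ} (hX : kWiseIndep μ X k) {p : α → ℝ}
    (hp : ∀ w a, pr μ (fun ω => X w ω = a) = p a) {T : Finset W} (hT : T.card ≤ k)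
    (y : W → α → ℝ) :
    ∑ ω, μ ω * ∏ w ∈ T, y w (X w ω) = ∏ w ∈ T, ∑ a, p a * y w a := by
  have key : ∀ a : T → α,
      ∏ w : T, p (a w) = ∑ ω, if (fun w : T => X w ω) = a then μ ω else 0 := by
    intro a
    let f : W → α := fun w => if h : w ∈ T then a ⟨w, h⟩ else Classical.arbitrary α
    have h1 := hX T hT f
    simp only [hp] at h1
    rw [← Finset.prod_coe_sort] at h1
    have h2 : ∀ w : T, f w = a w := fun w => by simp [f]
    simp only [h2] at h1
    have h3 : ∀ ω, (∀ w ∈ T, X w ω = f w) ↔ (fun w : T => X w ω) = a := fun ω => by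
      simp only [funext_iff, Subtype.forall]
      exact forall₂_congr fun w hw => by rw [← h2 ⟨w, hw⟩]
    simp only [← h1, pr, Finset.sum_filter, h3]
  rw [← Finset.prod_coe_sort T (fun w => ∑ a, p a * y w a), Finset.prod_univ_sum,
    Fintype.piFinset_univ]
  simp only [Finset.prod_mul_distrib, key, Finset.sum_mul]
  rw [Finset.sum_comm]
  refine Finset.sum_congr rfl fun ω _ => ?_
  simp only [ite_mul, zero_mul, Finset.sum_ite_eq, Finset.mem_univ, if_true]
  rw [← Finset.prod_coe_sort T]

lemma card_filter_card_image_le {W : Type*} [Fintype W] (k j : ℕ) :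
    (Finset.univ.filter fun f : Fin k → W => (Finset.univ.image f).card = j).card ≤
      j ^ k * Fintype.card W ^ j := by
  have hsub : (Finset.univ.filter fun f : Fin k → W => (Finset.univ.image f).card = j) ⊆
      (Finset.univ : Finset ((Fin k → Fin j) × (Fin j → W))).image fun x => x.2 ∘ x.1 := by
    intro f hf
    rw [Finset.mem_filter] at hf
    let e := (Finset.univ.image f).equivFinOfCardEq hf.2
    refine Finset.mem_image.2 ⟨(fun i => e ⟨f i, by simp⟩, fun i => e.symm i), by simp, ?_⟩
    ext i
    simp
  refine (Finset.card_le_card hsub).trans (Finset.card_image_le.trans ?_)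
  simp

lemma prod_sum_pow_le {W α : Type*} [Fintype W] [Fintype α] {p y : α → ℝ} (hp : ∀ a, 0 ≤ p a)
    (hy : ∀ a, |y a| ≤ 1) (hmean : ∑ a, p a * y a = 0) {σ : ℝ} (hσ : ∑ a, p a * y a ^ 2 ≤ σ)
    {k : ℕ} (f : Fin k → W) :
    ∏ w ∈ Finset.univ.image f, ∑ a, p a * y a ^ (Finset.univ.filter fun i => f i = w).card ≤
      if (Finset.univ.image f).card ≤ k / 2 then σ ^ (Finset.univ.image f).card else 0 := by
  have hσ0 : 0 ≤ σ := (Finset.sum_nonneg fun a _ => mul_nonneg (hp a) (sq_nonneg _)).trans hσ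
  by_cases h : ∃ w ∈ Finset.univ.image f, (Finset.univ.filter fun i => f i = w).card = 1
  · obtain ⟨w, hw, hw1⟩ := h
    rw [Finset.prod_eq_zero hw (by simpa [hw1] using hmean)]
    positivity
  · push Not at h
    have h2 : ∀ w ∈ Finset.univ.image f, 2 ≤ (Finset.univ.filter fun i => f i = w).card := by
      intro w hw
      have h1 := h w hw
      have : 0 < (Finset.univ.filter fun i => f i = w).card := by
        obtain ⟨i, -, hi⟩ := Finset.mem_image.1 hw
        exact Finset.card_pos.2 ⟨i, by simp [hi]⟩
      omega
    have hcard : (Finset.univ.image f).card * 2 ≤ k := by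
      have h3 := Finset.card_eq_sum_card_image f (Finset.univ : Finset (Fin k))
      rw [Finset.card_univ, Fintype.card_fin] at h3
      exact (Finset.card_nsmul_le_sum _ _ _ h2).trans_eq h3.symm
    rw [if_pos (by omega)]
    refine (le_abs_self _).trans ?_
    rw [Finset.abs_prod, ← Finset.prod_const]
    refine Finset.prod_le_prod (fun _ _ => abs_nonneg _) fun w hw => ?_
    refine (Finset.abs_sum_le_sum_abs _ _).trans (le_trans ?_ hσ)
    refine Finset.sum_le_sum fun a _ => ?_
    rw [abs_mul, abs_of_nonneg (hp a), abs_pow, ← sq_abs (y a)]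
    exact mul_le_mul_of_nonneg_left
      (pow_le_pow_of_le_one (abs_nonneg _) (hy a) (h2 w hw)) (hp a)

/-- Bound on the `k`-th central moment of a sum of `k`-wise independent bounded variables. -/
lemma sum_mul_sum_pow_le {Ω W α : Type*} [Fintype Ω] [Fintype W] [Fintype α] [Nonempty α]
    {μ : Ω → ℝ} {X : W → Ω → α} {k : ℕ} (hX : kWiseIndep μ X k) {p y : α → ℝ}
    (hpX : ∀ w a, pr μ (fun ω => X w ω = a) = p a) (hp : ∀ a, 0 ≤ p a)
    (hy : ∀ a, |y a| ≤ 1) (hmean : ∑ a, p a * y a = 0) {σ : ℝ} (hσ : ∑ a, p a * y a ^ 2 ≤ σ)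
    (hW : 1 ≤ Fintype.card W * σ) :
    ∑ ω, μ ω * (∑ w, y (X w ω)) ^ k ≤
      ((k / 2 + 1 : ℕ) * k ^ k : ℝ) * (Fintype.card W * σ) ^ (k / 2) := by
  have hσ0 : 0 ≤ σ := (Finset.sum_nonneg fun a _ => mul_nonneg (hp a) (sq_nonneg _)).trans hσ
  calc ∑ ω, μ ω * (∑ w, y (X w ω)) ^ k
      = ∑ f : Fin k → W, ∏ w ∈ Finset.univ.image f,
          ∑ a, p a * y a ^ (Finset.univ.filter fun i => f i = w).card := by
        simp only [Fintype.sum_pow, Finset.mul_sum]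
        rw [Finset.sum_comm]
        refine Finset.sum_congr rfl fun f _ => ?_
        rw [← sum_mul_prod_of_kWiseIndep hX hpX
          (Finset.card_image_le.trans (by simp))
          (fun w a => y a ^ (Finset.univ.filter fun i => f i = w).card)]
        refine Finset.sum_congr rfl fun ω _ => ?_
        rw [Finset.prod_comp (fun w => y (X w ω)) f]
    _ ≤ ∑ f : Fin k → W, if (Finset.univ.image f).card ≤ k / 2 then
          σ ^ (Finset.univ.image f).card else 0 :=
        Finset.sum_le_sum fun f _ => prod_sum_pow_le hp hy hmean hσ f
    _ = ∑ j ∈ Finset.range (k / 2 + 1),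
          ∑ f : Fin k → W with (Finset.univ.image f).card = j, σ ^ j := by
        simp only [Finset.sum_filter]
        rw [Finset.sum_comm]
        refine Finset.sum_congr rfl fun f _ => ?_
        simp [Finset.sum_ite_eq]
    _ ≤ ∑ j ∈ Finset.range (k / 2 + 1), (k ^ k : ℝ) * (Fintype.card W * σ) ^ (k / 2) := by
        refine Finset.sum_le_sum fun j hj => ?_
        have hj' : j ≤ k / 2 := Nat.lt_succ_iff.1 (Finset.mem_range.1 hj)
        rw [Finset.sum_const, nsmul_eq_mul]
        calc _ ≤ ((j ^ k * Fintype.card W ^ j : ℕ) : ℝ) * σ ^ j := by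
              gcongr
              exact card_filter_card_image_le k j
          _ = (j : ℝ) ^ k * (Fintype.card W * σ) ^ j := by push_cast; ring
          _ ≤ _ := by
              gcongr
              omega
    _ = _ := by
        rw [Finset.sum_const, Finset.card_range, nsmul_eq_mul, mul_assoc]

lemma pr_le_div_pow {Ω : Type*} [Fintype Ω] {μ : Ω → ℝ} (hμ : ∀ ω, 0 ≤ μ ω) (Y : Ω → ℝ)
    {k : ℕ} (hk : Even k) {t : ℝ} (ht : 0 < t) :
    pr μ (fun ω => t < Y ω) ≤ (∑ ω, μ ω * Y ω ^ k) / t ^ k := by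
  rw [le_div_iff₀ (pow_pos ht k), pr, Finset.sum_mul, Finset.sum_filter]
  refine Finset.sum_le_sum fun ω _ => ?_
  split_ifs with h
  · exact mul_le_mul_of_nonneg_left (pow_le_pow_left₀ ht.le h.le k) (hμ ω)
  · exact mul_nonneg (hμ ω) (hk.pow_nonneg _)

lemma pr_mono {Ω : Type*} [Fintype Ω] {μ : Ω → ℝ} (hμ : ∀ ω, 0 ≤ μ ω) {E F : Ω → Prop}
    (h : ∀ ω, E ω → F ω) : pr μ E ≤ pr μ F :=
  Finset.sum_le_sum_of_subset_of_nonneg (Finset.monotone_filter_right _ fun ω _ => h ω) fun ω _ _ => hμ ω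

lemma pr_or_le {Ω : Type*} [Fintype Ω] {μ : Ω → ℝ} (hμ : ∀ ω, 0 ≤ μ ω) (E F : Ω → Prop) :
    pr μ (fun ω => E ω ∨ F ω) ≤ pr μ E + pr μ F := by
  simp only [pr, Finset.sum_filter, ← Finset.sum_add_distrib]
  refine Finset.sum_le_sum fun ω _ => ?_
  have := hμ ω
  by_cases hE : E ω <;> by_cases hF : F ω <;> simp [hE, hF, this]

lemma pr_exists_le {Ω ι : Type*} [Fintype Ω] [Fintype ι] {μ : Ω → ℝ} (hμ : ∀ ω, 0 ≤ μ ω)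
    (E : ι → Ω → Prop) : pr μ (fun ω => ∃ i, E i ω) ≤ ∑ i, pr μ (E i) := by
  simp only [pr, Finset.sum_filter]
  rw [Finset.sum_comm]
  refine Finset.sum_le_sum fun ω _ => ?_
  split_ifs with h
  · obtain ⟨i, hi⟩ := h
    refine le_trans ?_ (Finset.single_le_sum (f := fun i => if E i ω then μ ω else 0)
      (fun i _ => ite_nonneg (hμ ω) le_rfl) (Finset.mem_univ i))
    simp [hi]
  · exact Finset.sum_nonneg fun i _ => ite_nonneg (hμ ω) le_rfl

/-- Upper tail bound for a sum of `k`-wise independent `[0,1]`-valued variables. -/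
lemma pr_sum_gt_le {Ω W α : Type*} [Fintype Ω] [Fintype W] [Fintype α]
    {μ : Ω → ℝ} (hμ : ∀ ω, 0 ≤ μ ω) {X : W → Ω → α} {k : ℕ} (hk : Even k)
    (hX : kWiseIndep μ X k) {p g : α → ℝ}
    (hpX : ∀ w a, pr μ (fun ω => X w ω = a) = p a) (hp : ∀ a, 0 ≤ p a) (hp1 : ∑ a, p a = 1)
    (hg0 : ∀ a, 0 ≤ g a) (hg1 : ∀ a, g a ≤ 1) {m : ℝ} (hm : ∑ a, p a * g a ≤ m)
    (hW : 1 ≤ Fintype.card W * m) {t : ℝ} (ht : 0 < t) :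
    pr μ (fun ω => Fintype.card W * m + t < ∑ w, g (X w ω)) ≤
      ((k / 2 + 1 : ℕ) * k ^ k : ℝ) * (Fintype.card W * m) ^ (k / 2) / t ^ k := by
  have : Nonempty α := by
    by_contra h
    rw [not_nonempty_iff] at h
    simp at hp1
  set e := ∑ a, p a * g a with he
  have he0 : 0 ≤ e := Finset.sum_nonneg fun a _ => mul_nonneg (hp a) (hg0 a)
  have he1 : e ≤ 1 := by
    rw [← hp1]
    exact Finset.sum_le_sum fun a _ => mul_le_of_le_one_right (hp a) (hg1 a)
  have hmean : ∑ a, p a * (g a - e) = 0 := by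
    simp only [mul_sub, Finset.sum_sub_distrib, ← Finset.sum_mul, hp1, ← he]
    ring
  have hvar : ∑ a, p a * (g a - e) ^ 2 ≤ m := by
    have h1 : ∑ a, p a * (g a - e) ^ 2 = ∑ a, p a * (g a) ^ 2 - e ^ 2 := by
      have : ∀ a, p a * (g a - e) ^ 2 = p a * (g a) ^ 2 - 2 * e * (p a * g a) + p a * e ^ 2 :=
        fun a => by ring
      simp only [this, Finset.sum_add_distrib, Finset.sum_sub_distrib, ← Finset.sum_mul,
        ← Finset.mul_sum, hp1, ← he]
      ring
    have h2 : ∑ a, p a * (g a) ^ 2 ≤ e := Finset.sum_le_sum fun a _ =>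
      mul_le_mul_of_nonneg_left (by nlinarith [hg0 a, hg1 a]) (hp a)
    nlinarith [sq_nonneg e]
  have habs : ∀ a, |g a - e| ≤ 1 := fun a =>
    abs_le.2 ⟨by linarith [hg0 a], by linarith [hg1 a]⟩
  refine le_trans (pr_mono hμ fun ω hω => ?_)
    ((pr_le_div_pow hμ (fun ω => ∑ w, (g (X w ω) - e)) hk ht).trans
      (div_le_div_of_nonneg_right
        (sum_mul_sum_pow_le hX hpX hp habs hmean hvar hW) (pow_pos ht k).le))
  have : (Fintype.card W : ℝ) * e ≤ Fintype.card W * m := by gcongr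
  rw [Finset.sum_sub_distrib, Finset.sum_const, Finset.card_univ, nsmul_eq_mul]
  linarith

lemma one_div_log_two_le : 1 / Real.log 2 ≤ 2 := by
  rw [div_le_iff₀ (Real.log_pos one_lt_two)]
  linarith [Real.log_two_gt_d9]

lemma logb_two_one_add_le {x : ℝ} (hx : 0 ≤ x) : Real.logb 2 (1 + x) ≤ 2 * x := by
  have h1 := Real.log_le_sub_one_of_pos (show 0 < 1 + x by linarith)
  calc Real.logb 2 (1 + x) = Real.log (1 + x) * (1 / Real.log 2) := by rw [Real.logb]; ring
    _ ≤ x * 2 := mul_le_mul (by linarith) one_div_log_two_le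
        (one_div_nonneg.2 (Real.log_pos one_lt_two).le) hx
    _ = 2 * x := mul_comm _ _

/-- If `P` splits as a part dominated by `(1 + η) Q` and a small remainder, then `P` is close
to `Q` in relative entropy. -/
lemma relEnt_le {V : Type*} [Fintype V] {P P₁ P₂ Q : V → ℝ} (hP : ∀ v, P v = P₁ v + P₂ v)
    (hP₁ : ∀ v, 0 ≤ P₁ v) (hP₂ : ∀ v, 0 ≤ P₂ v) (hQ : ∀ v, 0 ≤ Q v) (hP1 : ∑ v, P v ≤ 1)
    {η τ L : ℝ} (hη0 : 0 ≤ η) (hη1 : η ≤ 1)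
    (hdom : ∀ v, 0 < Q v → P₁ v ≤ (1 + η) * Q v) (hτ : ∑ v, P₂ v ≤ τ)
    (hL : 0 ≤ L) (hPQ : ∀ v, 0 < Q v → 1 + P₂ v / Q v ≤ 2 ^ L) :
    relEnt P Q ≤ 2 * η + τ * (4 + L) := by
  have hP0 : ∀ v, 0 ≤ P v := fun v => by linarith [hP v, hP₁ v, hP₂ v]
  have hterm : ∀ v, P v * Real.logb 2 (P v / Q v) ≤ 2 * η * P v + P₂ v * (4 + L) := by
    intro v
    have hrhs : 0 ≤ 2 * η * P v + P₂ v * (4 + L) :=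
      add_nonneg (by have := hP0 v; positivity) (mul_nonneg (hP₂ v) (by linarith))
    rcases (hQ v).eq_or_lt with h0 | hQv
    · simpa [← h0] using hrhs
    rcases (hP0 v).eq_or_lt with h0 | hPv
    · simpa [← h0] using mul_nonneg (hP₂ v) (by linarith : 0 ≤ 4 + L)
    set x := P₂ v / Q v with hx
    have hx0 : 0 ≤ x := div_nonneg (hP₂ v) hQv.le
    have hle : P v / Q v ≤ (1 + η) * (1 + x) := by
      have : P₁ v / Q v ≤ 1 + η := (div_le_iff₀ hQv).2 (hdom v hQv)
      rw [hP v, add_div, ← hx]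
      nlinarith
    have hlog : Real.logb 2 (P v / Q v) ≤ 2 * η + Real.logb 2 (1 + x) := by
      refine (Real.logb_le_logb_of_le one_lt_two (div_pos hPv hQv) hle).trans ?_
      rw [Real.logb_mul (by positivity) (by positivity)]
      linarith [logb_two_one_add_le hη0]
    have hlogx : Real.logb 2 (1 + x) ≤ L :=
      (Real.logb_le_iff_le_rpow one_lt_two (by linarith)).2 (hPQ v hQv)
    have h1 : P₁ v * Real.logb 2 (1 + x) ≤ 4 * P₂ v :=
      calc P₁ v * Real.logb 2 (1 + x) ≤ ((1 + η) * Q v) * (2 * x) :=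
            mul_le_mul (hdom v hQv) (logb_two_one_add_le hx0)
              (Real.logb_nonneg one_lt_two (by linarith)) (by positivity)
        _ = 2 * (1 + η) * P₂ v := by rw [hx]; field_simp
        _ ≤ 4 * P₂ v := by nlinarith [hP₂ v]
    have h2 : P₂ v * Real.logb 2 (1 + x) ≤ P₂ v * L :=
      mul_le_mul_of_nonneg_left hlogx (hP₂ v)
    calc P v * Real.logb 2 (P v / Q v) ≤ P v * (2 * η + Real.logb 2 (1 + x)) :=
          mul_le_mul_of_nonneg_left hlog (hP0 v)
      _ = 2 * η * P v + (P₁ v * Real.logb 2 (1 + x) + P₂ v * Real.logb 2 (1 + x)) := by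
          rw [hP v]; ring
      _ ≤ _ := by linarith
  calc relEnt P Q ≤ ∑ v, (2 * η * P v + P₂ v * (4 + L)) := Finset.sum_le_sum fun v _ => hterm v
    _ = 2 * η * ∑ v, P v + (∑ v, P₂ v) * (4 + L) := by
        rw [Finset.sum_add_distrib, Finset.mul_sum, Finset.sum_mul]
    _ ≤ 2 * η * 1 + τ * (4 + L) := by gcongr
    _ = _ := by ring

lemma sub_le_mul_log_div {x y : ℝ} (hx : 0 ≤ x) (hy : 0 ≤ y) (hxy : y = 0 → x = 0) :
    x - y ≤ x * Real.log (x / y) := by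
  rcases hx.eq_or_lt with rfl | hx
  · simpa using hy
  have hy' : 0 < y := hy.lt_of_ne fun h => hx.ne' (hxy h.symm)
  have h := Real.log_le_sub_one_of_pos (div_pos hy' hx)
  rw [← inv_div, Real.log_inv] at h
  have h2 := mul_le_mul_of_nonneg_left h hx.le
  rw [mul_sub, inv_div, mul_div_cancel₀ _ hx.ne'] at h2
  linarith

lemma mutualInfo_nonneg {M Z : Type*} [Fintype M] [Fintype Z] {P : M → Z → ℝ}
    (hP : ∀ m z, 0 ≤ P m z) (hP1 : ∑ m, ∑ z, P m z = 1) : 0 ≤ mutualInfo P := by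
  have hle1 : ∀ m z, P m z ≤ ∑ z', P m z' := fun m z =>
    Finset.single_le_sum (f := fun z' => P m z') (fun z' _ => hP m z') (Finset.mem_univ z)
  have hle2 : ∀ m z, P m z ≤ ∑ m', P m' z := fun m z =>
    Finset.single_le_sum (f := fun m' => P m' z) (fun m' _ => hP m' z) (Finset.mem_univ m)
  have hsum : ∑ m, ∑ z, (P m z - (∑ z', P m z') * ∑ m', P m' z) = 0 := by
    simp only [Finset.sum_sub_distrib, hP1]
    simp only [← Finset.mul_sum, ← Finset.sum_mul, hP1]
    rw [Finset.sum_comm, hP1]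
    ring
  have key : 0 ≤ ∑ m, ∑ z, P m z * Real.log (P m z / ((∑ z', P m z') * ∑ m', P m' z)) := by
    rw [← hsum]
    refine Finset.sum_le_sum fun m _ => Finset.sum_le_sum fun z _ => ?_
    refine sub_le_mul_log_div (hP m z) (mul_nonneg ((hP m z).trans (hle1 m z))
      ((hP m z).trans (hle2 m z))) fun h => ?_
    rcases mul_eq_zero.1 h with h | h
    · exact le_antisymm (h ▸ hle1 m z) (hP m z)
    · exact le_antisymm (h ▸ hle2 m z) (hP m z)
  simp only [mutualInfo, Real.logb, mul_div_assoc', ← Finset.sum_div]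
  exact div_nonneg key (Real.log_pos one_lt_two).le

/-- Exponential tilting: a finite weighted sum of exponentials with negative log-mean drops
below `1` for some positive exponent. -/
lemma exists_sum_mul_rpow_lt_one {ι : Type*} [Fintype ι] {w r : ι → ℝ}
    (hr : ∀ i, w i ≠ 0 → 0 < r i) (hw1 : ∑ i, w i = 1)
    (hneg : ∑ i, w i * Real.log (r i) < 0) :
    ∃ s : ℝ, 0 < s ∧ ∑ i, w i * r i ^ s < 1 := by
  have hderiv : HasDerivAt (fun s : ℝ => ∑ i, w i * r i ^ s) (∑ i, w i * Real.log (r i)) 0 := by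
    refine HasDerivAt.fun_sum fun i _ => ?_
    by_cases hwi : w i = 0
    · simpa [hwi] using hasDerivAt_const (0 : ℝ) (0 : ℝ)
    · simpa using (Real.hasStrictDerivAt_const_rpow (hr i hwi) 0).hasDerivAt.const_mul (w i)
  have h0 : ∑ i, w i * r i ^ (0 : ℝ) = 1 := by simpa using hw1
  have hev := (hasDerivAt_iff_tendsto_slope.1 hderiv).eventually_lt_const hneg
  have hev' : ∀ᶠ s in nhdsWithin (0 : ℝ) (Set.Ioi 0),
      slope (fun s : ℝ => ∑ i, w i * r i ^ s) 0 s < 0 :=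
    hev.filter_mono (nhdsWithin_mono _ fun s hs => ne_of_gt hs)
  obtain ⟨s, hs, hs0⟩ := (hev'.and self_mem_nhdsWithin).exists
  refine ⟨s, hs0, ?_⟩
  rw [slope_def_field, sub_zero, div_lt_iff₀ hs0, zero_mul, h0] at hs
  linarith

lemma sum_sum_prod_eq_pow {A B : Type*} [Fintype A] [Fintype B] (F : A → B → ℝ) (n : ℕ) :
    ∑ u : Fin n → A, ∑ v : Fin n → B, ∏ j, F (u j) (v j) = (∑ a, ∑ b, F a b) ^ n := by
  have h : ∀ u : Fin n → A, ∑ v : Fin n → B, ∏ j, F (u j) (v j) = ∏ j, ∑ b, F (u j) b :=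
    fun u => (Fintype.prod_sum fun j b => F (u j) b).symm
  simp only [h]
  rw [← Fintype.prod_sum fun (_ : Fin n) a => ∑ b, F a b]
  simp

/-- One-shot soft covering with `k`-wise independent codewords. -/
lemma pr_relEnt_gt_le {Ω W α β : Type*} [Fintype Ω] [Fintype W] [Nonempty W] [Fintype α]
    [Fintype β] {μ : Ω → ℝ} (hμ : ∀ ω, 0 ≤ μ ω) {X : W → Ω → α} {k : ℕ} (hk : Even k)
    (hX : kWiseIndep μ X k) {p : α → ℝ} (hpX : ∀ w a, pr μ (fun ω => X w ω = a) = p a)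
    (hp : ∀ a, 0 ≤ p a) (hp1 : ∑ a, p a = 1) {K : α → β → ℝ} (hK : ∀ a b, 0 ≤ K a b)
    (hK1 : ∀ a, ∑ b, K a b = 1) {Q : β → ℝ} (hQ : ∀ b, Q b = ∑ a, p a * K a b)
    {c η m L : ℝ} (hc : 0 < c) (hη0 : 0 < η) (hη1 : η ≤ 1) (hL : 0 ≤ L)
    (hm : ∑ a, p a * ∑ b, (if 0 < Q b ∧ c * Q b < K a b then K a b else 0) ≤ m)
    (hQL : ∀ b, 0 < Q b → 1 + 1 / Q b ≤ 2 ^ L)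
    (hWc : 1 ≤ Fintype.card W * (1 / c)) (hWm : 1 ≤ Fintype.card W * m) :
    pr μ (fun ω => 2 * η + 2 * m * (4 + L) <
        relEnt (fun b => (∑ w, K (X w ω) b) / Fintype.card W) Q) ≤
      Fintype.card β * (((k / 2 + 1 : ℕ) * k ^ k : ℝ) *
          (Fintype.card W * (1 / c)) ^ (k / 2) / (η * (Fintype.card W * (1 / c))) ^ k) +
        ((k / 2 + 1 : ℕ) * k ^ k : ℝ) *
          (Fintype.card W * m) ^ (k / 2) / (Fintype.card W * m) ^ k := by
  have hM : (0 : ℝ) < Fintype.card W := Nat.cast_pos.2 Fintype.card_pos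
  have hQ0 : ∀ b, 0 ≤ Q b := fun b => by
    rw [hQ]
    exact Finset.sum_nonneg fun a _ => mul_nonneg (hp a) (hK a b)
  have hKle : ∀ a b, K a b ≤ 1 := fun a b => by
    rw [← hK1 a]
    exact Finset.single_le_sum (fun b _ => hK a b) (Finset.mem_univ b)
  let g₁ : β → α → ℝ := fun b a => if K a b ≤ c * Q b then K a b / (c * Q b) else 0
  let g₂ : α → ℝ := fun a => ∑ b, if 0 < Q b ∧ c * Q b < K a b then K a b else 0
  have hg₁0 : ∀ b a, 0 ≤ g₁ b a := fun b a =>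
    ite_nonneg (div_nonneg (hK a b) (mul_nonneg hc.le (hQ0 b))) le_rfl
  have hg₁1 : ∀ b a, g₁ b a ≤ 1 := fun b a => by
    simp only [g₁]
    split_ifs with h
    · exact div_le_one_of_le₀ h (mul_nonneg hc.le (hQ0 b))
    · exact zero_le_one
  have hg₁m : ∀ b, ∑ a, p a * g₁ b a ≤ 1 / c := fun b => by
    calc ∑ a, p a * g₁ b a ≤ ∑ a, p a * K a b / (c * Q b) := by
          refine Finset.sum_le_sum fun a _ => ?_
          rw [mul_div_assoc]
          refine mul_le_mul_of_nonneg_left ?_ (hp a)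
          simp only [g₁]
          split_ifs
          · exact le_rfl
          · exact div_nonneg (hK a b) (mul_nonneg hc.le (hQ0 b))
      _ = Q b / (c * Q b) := by rw [← Finset.sum_div, ← hQ]
      _ ≤ 1 / c := by
          rcases (hQ0 b).eq_or_lt with h | h
          · rw [← h]
            simpa using hc.le
          · exact le_of_eq (by field_simp)
  have hg₂0 : ∀ a, 0 ≤ g₂ a := fun a =>
    Finset.sum_nonneg fun b _ => ite_nonneg (hK a b) le_rfl
  have hg₂1 : ∀ a, g₂ a ≤ 1 := fun a => by
    rw [← hK1 a]
    refine Finset.sum_le_sum fun b _ => ?_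
    split_ifs
    · exact le_rfl
    · exact hK a b
  have hbad₁ : ∀ b, _ := fun b => pr_sum_gt_le hμ hk hX hpX hp hp1 (hg₁0 b) (hg₁1 b) (hg₁m b) hWc
    (t := η * (Fintype.card W * (1 / c))) (by positivity)
  have hbad₂ := pr_sum_gt_le hμ hk hX hpX hp hp1 hg₂0 hg₂1 hm hWm
    (t := Fintype.card W * m) (by linarith)
  have hbad := (pr_exists_le hμ _).trans (Finset.sum_le_sum fun b _ => hbad₁ b)
  rw [Finset.sum_const, Finset.card_univ, nsmul_eq_mul] at hbad
  refine le_trans (pr_mono hμ fun ω hω => ?_) ((pr_or_le hμ _ _).trans (add_le_add hbad hbad₂))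
  by_contra hgood
  push Not at hgood
  obtain ⟨hgood₁, hgood₂⟩ := hgood
  refine absurd hω (not_lt.2 ?_)
  let P₁ : β → ℝ := fun b =>
    (∑ w, if 0 < Q b ∧ c * Q b < K (X w ω) b then 0 else K (X w ω) b) / Fintype.card W
  let P₂ : β → ℝ := fun b =>
    (∑ w, if 0 < Q b ∧ c * Q b < K (X w ω) b then K (X w ω) b else 0) / Fintype.card W
  have hP₂0 : ∀ b, 0 ≤ P₂ b := fun b =>
    div_nonneg (Finset.sum_nonneg fun w _ => ite_nonneg (hK _ _) le_rfl) hM.le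
  have hP₂1 : ∀ b, P₂ b ≤ 1 := fun b => by
    refine div_le_one_of_le₀ ?_ hM.le
    calc _ ≤ ∑ w : W, (1 : ℝ) := Finset.sum_le_sum fun w _ => by
          split_ifs
          · exact hKle _ _
          · exact zero_le_one
      _ = _ := by simp
  refine relEnt_le (P₁ := P₁) (P₂ := P₂) (fun b => ?_)
    (fun b => div_nonneg (Finset.sum_nonneg fun w _ => ite_nonneg le_rfl (hK _ _)) hM.le)
    hP₂0 hQ0 ?_ hη0.le hη1 (fun b hb => ?_) ?_ hL fun b hb => ?_
  · simp only [P₁, P₂]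
    rw [← add_div, ← Finset.sum_add_distrib]
    congr 1
    refine Finset.sum_congr rfl fun w _ => ?_
    split_ifs <;> simp
  · rw [← Finset.sum_div, Finset.sum_comm]
    simp [hK1]
  · have h := hgood₁ b
    have hsum : ∑ w, g₁ b (X w ω) = P₁ b * Fintype.card W / (c * Q b) := by
      simp only [P₁]
      rw [div_mul_cancel₀ _ hM.ne', Finset.sum_div]
      refine Finset.sum_congr rfl fun w _ => ?_
      simp only [g₁, hb, true_and, ← not_le, ite_not]
      split_ifs <;> simp
    rw [hsum, div_le_iff₀ (mul_pos hc hb)] at h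
    refine le_of_mul_le_mul_right (h.trans_eq ?_) hM
    field_simp
  · simp only [P₂]
    rw [← Finset.sum_div, Finset.sum_comm, div_le_iff₀ hM]
    exact hgood₂.trans_eq (by ring)
  · refine le_trans ?_ (hQL b hb)
    gcongr
    exact hP₂1 b

section Channel

variable {𝒰 𝒱 : Type*} [Fintype 𝒰] [Fintype 𝒱] {QU : 𝒰 → ℝ} {QVU : 𝒰 → 𝒱 → ℝ}

lemma exists_tilted_sum_lt_one (hQU0 : ∀ u, 0 ≤ QU u) (hQU1 : ∑ u, QU u = 1)
    (hQVU0 : ∀ u v, 0 ≤ QVU u v) (hQVU1 : ∀ u, ∑ v, QVU u v = 1) {a : ℝ}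
    (ha : mutualInfo (fun u v => QU u * QVU u v) < a) :
    ∃ s : ℝ, 0 < s ∧ ∑ u, ∑ v, QU u * QVU u v *
      (QVU u v / (∑ u', QU u' * QVU u' v) / 2 ^ a) ^ s < 1 := by
  have hpos : ∀ u v, QU u * QVU u v ≠ 0 → 0 < QVU u v / ∑ u', QU u' * QVU u' v := by
    intro u v h
    refine div_pos ((hQVU0 u v).lt_of_ne' (right_ne_zero_of_mul h)) ?_
    exact ((mul_nonneg (hQU0 u) (hQVU0 u v)).lt_of_ne' h).trans_le
      (Finset.single_le_sum (f := fun u' => QU u' * QVU u' v)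
        (fun u' _ => mul_nonneg (hQU0 u') (hQVU0 u' v)) (Finset.mem_univ u))
  have hw1 : ∑ u, ∑ v, QU u * QVU u v = 1 := by
    simp only [← Finset.mul_sum, hQVU1, mul_one, hQU1]
  have hI : ∑ u, ∑ v, QU u * QVU u v *
      Real.log (QVU u v / (∑ u', QU u' * QVU u' v) / 2 ^ a) =
      (mutualInfo (fun u v => QU u * QVU u v) - a) * Real.log 2 := by
    have hlog2 := (Real.log_pos one_lt_two).ne'
    calc _ = ∑ u, ∑ v, (QU u * QVU u v * Real.logb 2 (QU u * QVU u v /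
            ((∑ v', QU u * QVU u v') * ∑ u', QU u' * QVU u' v)) * Real.log 2 -
            QU u * QVU u v * (a * Real.log 2)) := by
          refine Finset.sum_congr rfl fun u _ => Finset.sum_congr rfl fun v _ => ?_
          by_cases h : QU u * QVU u v = 0
          · simp [h]
          · rw [Real.log_div (hpos u v h).ne' (by positivity), Real.log_rpow two_pos,
              ← Finset.mul_sum, hQVU1, mul_one,
              mul_div_mul_left _ _ (left_ne_zero_of_mul h), Real.logb]
            field_simp
      _ = _ := by
          simp only [Finset.sum_sub_distrib, ← Finset.sum_mul, hw1]
          rw [mutualInfo]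
          ring
  obtain ⟨s, hs0, hs⟩ := exists_sum_mul_rpow_lt_one (ι := 𝒰 × 𝒱)
    (w := fun x => QU x.1 * QVU x.1 x.2)
    (r := fun x => QVU x.1 x.2 / (∑ u', QU u' * QVU u' x.2) / 2 ^ a)
    (fun x hx => div_pos (hpos x.1 x.2 hx) (by positivity))
    (by rw [Fintype.sum_prod_type]; exact hw1)
    (by
      rw [Fintype.sum_prod_type]
      exact hI.trans_lt (mul_neg_of_neg_of_pos (sub_neg.2 ha) (Real.log_pos one_lt_two)))
  exact ⟨s, hs0, by rwa [Fintype.sum_prod_type] at hs⟩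

lemma sum_atypical_le_pow (hQU0 : ∀ u, 0 ≤ QU u) (hQVU0 : ∀ u v, 0 ≤ QVU u v) {c s : ℝ}
    (hc : 0 < c) (hs : 0 < s) (n : ℕ) :
    ∑ u : Fin n → 𝒰, (∏ j, QU (u j)) * ∑ v : Fin n → 𝒱,
        (if 0 < ∏ j, (∑ u', QU u' * QVU u' (v j)) ∧
          c ^ n * ∏ j, (∑ u', QU u' * QVU u' (v j)) < ∏ j, QVU (u j) (v j)
        then ∏ j, QVU (u j) (v j) else 0) ≤
      (∑ u, ∑ v, QU u * QVU u v * (QVU u v / (∑ u', QU u' * QVU u' v) / c) ^ s) ^ n := by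
  rw [← sum_sum_prod_eq_pow]
  have hQV0 : ∀ v, 0 ≤ ∑ u', QU u' * QVU u' v := fun v =>
    Finset.sum_nonneg fun u _ => mul_nonneg (hQU0 u) (hQVU0 u v)
  have hr0 : ∀ u v, 0 ≤ QVU u v / (∑ u', QU u' * QVU u' v) / c := fun u v =>
    div_nonneg (div_nonneg (hQVU0 u v) (hQV0 v)) hc.le
  refine Finset.sum_le_sum fun u _ => ?_
  rw [Finset.mul_sum]
  refine Finset.sum_le_sum fun v _ => ?_
  have hW : 0 ≤ (∏ j, QU (u j)) * ∏ j, QVU (u j) (v j) :=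
    mul_nonneg (Finset.prod_nonneg fun j _ => hQU0 _) (Finset.prod_nonneg fun j _ => hQVU0 _ _)
  rw [Finset.prod_mul_distrib, Finset.prod_mul_distrib,
    Real.finsetProd_rpow _ _ (fun j _ => hr0 _ _)]
  split_ifs with h
  · refine le_mul_of_one_le_right hW (Real.one_le_rpow ?_ hs.le)
    rw [Finset.prod_div_distrib, Finset.prod_div_distrib, Finset.prod_const, Finset.card_univ,
      Fintype.card_fin, div_div, one_le_div (mul_pos h.1 (pow_pos hc n)), mul_comm]
    exact h.2.le
  · rw [mul_zero]
    exact mul_nonneg hW (Real.rpow_nonneg (Finset.prod_nonneg fun j _ => hr0 _ _) _)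

/-- Positive values of an `n`-fold product mass function decay at most exponentially in `n`. -/
lemma exists_one_add_one_div_prod_le (q : 𝒱 → ℝ) (hq0 : ∀ v, 0 ≤ q v) (hq1 : ∀ v, q v ≤ 1) :
    ∃ l : ℝ, 0 ≤ l ∧ ∀ (n : ℕ) (v : Fin n → 𝒱), 0 < ∏ j, q (v j) →
      1 + 1 / ∏ j, q (v j) ≤ 2 ^ (1 + n * l) := by
  refine ⟨∑ v, |Real.logb 2 (q v)|, Finset.sum_nonneg fun _ _ => abs_nonneg _, ?_⟩
  intro n v hv
  set l := ∑ v, |Real.logb 2 (q v)| with hl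
  have hle1 : ∏ j, q (v j) ≤ 1 := Finset.prod_le_one (fun j _ => hq0 _) fun j _ => hq1 _
  have hj : ∀ j, 1 / q (v j) ≤ 2 ^ l := fun j => by
    have hqj : 0 < q (v j) :=
      (hq0 _).lt_of_ne' fun h => hv.ne' (Finset.prod_eq_zero (Finset.mem_univ j) h)
    rw [← Real.logb_le_iff_le_rpow one_lt_two (one_div_pos.2 hqj), one_div, Real.logb_inv]
    exact (neg_le_abs _).trans (Finset.single_le_sum (f := fun v => |Real.logb 2 (q v)|)
      (fun _ _ => abs_nonneg _) (Finset.mem_univ (v j)))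
  calc 1 + 1 / ∏ j, q (v j) ≤ 2 * (1 / ∏ j, q (v j)) := by
        have := (one_le_div hv).2 hle1
        linarith
    _ = 2 * ∏ j, 1 / q (v j) := by simp
    _ ≤ 2 * ∏ j : Fin n, (2 : ℝ) ^ l := by
        gcongr with j
        · exact fun j _ => one_div_nonneg.2 (hq0 _)
        · exact hj j
    _ = 2 ^ (1 + n * l) := by
        rw [Finset.prod_const, Finset.card_univ, Fintype.card_fin, Real.rpow_add two_pos,
          Real.rpow_one, mul_comm (n : ℝ) l, Real.rpow_mul two_pos.le, Real.rpow_natCast]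

end Channel

lemma eventually_two_mul_pow_add_le_pow {q r g l : ℝ} (hq0 : 0 ≤ q) (hr0 : 0 ≤ r) (hqg : q < g)
    (hrg : r < g) :
    ∀ᶠ n : ℕ in Filter.atTop, 2 * q ^ n + 2 * r ^ n * (4 + (1 + n * l)) ≤ g ^ n := by
  have hg : 0 < g := hq0.trans_lt hqg
  have hq : |q / g| < 1 := by rwa [abs_of_nonneg (by positivity), div_lt_one hg]
  have hr : |r / g| < 1 := by rwa [abs_of_nonneg (by positivity), div_lt_one hg]
  have h1 := tendsto_pow_const_mul_const_pow_of_abs_lt_one 0 hq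
  have h2 := tendsto_pow_const_mul_const_pow_of_abs_lt_one 0 hr
  have h3 := tendsto_pow_const_mul_const_pow_of_abs_lt_one 1 hr
  have h := ((h1.const_mul 2).add (h2.const_mul 10)).add (h3.const_mul (2 * l))
  filter_upwards [h.eventually_lt_const (show 2 * 0 + 10 * 0 + 2 * l * 0 < (1 : ℝ) by simp)]
    with n hn
  rw [← one_mul (g ^ n), ← div_le_iff₀ (pow_pos hg n)]
  refine le_trans (le_of_eq ?_) hn.le
  rw [div_pow, div_pow]
  ring

lemma mul_div_add_div_le {v C Y Z : ℝ} {h : ℕ} (hh : 0 < h) (hv : 1 ≤ v) (hC : 0 ≤ C)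
    (hY1 : 1 ≤ Y) (hCY : 2 * C ≤ Y) (hYZ : Y ^ 4 ≤ Z) :
    v * (C * (Y ^ 8) ^ h / ((Y ^ 2)⁻¹ * Y ^ 8) ^ (2 * h)) + C * Z ^ h / Z ^ (2 * h) ≤
      v / Y ^ (2 * h) := by
  have hY : 0 < Y := by linarith
  have hZ : 0 < Z := (pow_pos hY 4).trans_le hYZ
  have e1 : C * (Y ^ 8) ^ h / ((Y ^ 2)⁻¹ * Y ^ 8) ^ (2 * h) = C / Y ^ (4 * h) := by
    have : (Y ^ 2)⁻¹ * Y ^ 8 = Y ^ 6 := by field_simp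
    rw [this, div_eq_div_iff (by positivity) (by positivity)]
    ring
  have e2 : C * Z ^ h / Z ^ (2 * h) = C / Z ^ h := by
    rw [div_eq_div_iff (by positivity) (by positivity)]
    ring
  have e3 : C / Z ^ h ≤ v * (C / Y ^ (4 * h)) := by
    refine le_trans ?_ (le_mul_of_one_le_left (by positivity) hv)
    rw [pow_mul]
    gcongr
  have e4 : 2 * C ≤ Y ^ (2 * h) := hCY.trans (le_self_pow₀ hY1 (by omega))
  calc _ ≤ v * (C / Y ^ (4 * h)) + v * (C / Y ^ (4 * h)) := by rw [e1, e2]; linarith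
    _ = v * (2 * C) / (Y ^ (2 * h) * Y ^ (2 * h)) := by ring
    _ ≤ v * Y ^ (2 * h) / (Y ^ (2 * h) * Y ^ (2 * h)) := by gcongr
    _ = v / Y ^ (2 * h) := by field_simp

/-- Soft-covering lemma for `k`-wise independent codewords (Lemma 4): if `R' > I(U;V)`
then there are `γ₀, γ₁ > 0` such that for every even `k ≥ 4` and all large `n`, a random
code of `2^{R'n}` `k`-wise independent codewords drawn with marginal `Q_U^n` satisfies
`Pr[ D(P_V^{(𝒞)} ‖ Q_V^n) > 2^{−γ₁ n} ] ≤ 2^{(−kγ₀ + log₂|V|)n}`. -/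
theorem soft_covering_kwise_independent
    (𝒰 𝒱 : Type) [Fintype 𝒰] [Fintype 𝒱]
    (QU : 𝒰 → ℝ) (hQU0 : ∀ u, 0 ≤ QU u) (hQU1 : ∑ u, QU u = 1)
    (QVU : 𝒰 → 𝒱 → ℝ) (hQVU0 : ∀ u v, 0 ≤ QVU u v) (hQVU1 : ∀ u, ∑ v, QVU u v = 1)
    (R' : ℝ) (hR' : mutualInfo (fun u v => QU u * QVU u v) < R') :
    ∃ γ₀ γ₁ : ℝ, 0 < γ₀ ∧ 0 < γ₁ ∧
      ∀ k : ℕ, Even k → 4 ≤ k →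
        ∃ n₀ : ℕ, ∀ n : ℕ, n₀ ≤ n → ∀ b : ℕ, (b : ℝ) = R' * n →
          ∀ (Ω : Type) [Fintype Ω] (μ : Ω → ℝ),
            (∀ ω, 0 ≤ μ ω) → (∑ ω, μ ω) = 1 →
            ∀ U : Fin (2 ^ b) → Ω → (Fin n → 𝒰),
              kWiseIndep μ U k →
              (∀ w (u : Fin n → 𝒰), pr μ (fun ω => U w ω = u) = ∏ j, QU (u j)) →
              pr μ (fun ω =>
                (2 : ℝ) ^ (-(γ₁ * n)) <
                  relEnt
                    (fun v : Fin n → 𝒱 =>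
                      (∑ w, ∏ j, QVU (U w ω j) (v j)) / (2 : ℝ) ^ b)
                    (fun v : Fin n → 𝒱 => ∏ j, (∑ u, QU u * QVU u (v j))))
                ≤ (2 : ℝ) ^ ((-(k : ℝ) * γ₀ + Real.logb 2 (Fintype.card 𝒱)) * n) := by
  have hP0 : ∀ u v, 0 ≤ QU u * QVU u v := fun u v => mul_nonneg (hQU0 u) (hQVU0 u v)
  have hI0 := mutualInfo_nonneg hP0 (by simp only [← Finset.mul_sum, hQVU1, mul_one, hQU1])
  set I := mutualInfo (fun u v => QU u * QVU u v)
  obtain ⟨a, haI, haR⟩ := exists_between hR'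
  obtain ⟨s, hs0, hs1⟩ := exists_tilted_sum_lt_one hQU0 hQU1 hQVU0 hQVU1 haI
  have hc1 : (1 : ℝ) < 2 ^ a := Real.one_lt_rpow one_lt_two (hI0.trans_lt haI)
  have htail := sum_atypical_le_pow hQU0 hQVU0 (one_pos.trans hc1) hs0
  set θ := ∑ u, ∑ v, QU u * QVU u v * (QVU u v / (∑ u', QU u' * QVU u' v) / 2 ^ a) ^ s
  have hQV0 : ∀ v, 0 ≤ ∑ u, QU u * QVU u v := fun v => Finset.sum_nonneg fun u _ => hP0 u v
  have hθ0 : 0 ≤ θ := Finset.sum_nonneg fun u _ => Finset.sum_nonneg fun v _ =>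
    mul_nonneg (hP0 u v) (Real.rpow_nonneg
      (div_nonneg (div_nonneg (hQVU0 u v) (hQV0 v)) (one_pos.trans hc1).le) _)
  have hQV1 : ∀ v, ∑ u, QU u * QVU u v ≤ 1 := fun v => by
    rw [← hQU1]
    refine Finset.sum_le_sum fun u _ => mul_le_of_le_one_right (hQU0 u) ?_
    rw [← hQVU1 u]
    exact Finset.single_le_sum (fun v _ => hQVU0 u v) (Finset.mem_univ v)
  obtain ⟨l, hl0, hl⟩ := exists_one_add_one_div_prod_le _ hQV0 hQV1
  have hd : 0 < (R' - a) / 8 := by linarith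
  set d := (R' - a) / 8 with hd_def
  set c : ℝ := 2 ^ a
  set y : ℝ := 2 ^ d with hy
  have hy1 : 1 < y := Real.one_lt_rpow one_lt_two hd
  have hy0 : 0 < y := one_pos.trans hy1
  have hR : (2 : ℝ) ^ R' = c * y ^ 8 := by
    rw [hy, ← Real.rpow_mul_natCast two_pos.le, ← Real.rpow_add two_pos, hd_def]
    congr 1
    push_cast
    ring
  set r := max θ (c * y ^ 4)⁻¹
  have hr0 : 0 ≤ r := hθ0.trans (le_max_left _ _)
  have hr1 : r < 1 := max_lt hs1
    (inv_lt_one_of_one_lt₀ (one_lt_mul_of_lt_of_le hc1 (one_le_pow₀ hy1.le)))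
  have hq1 : (y ^ 2)⁻¹ < 1 := inv_lt_one_of_one_lt₀ (one_lt_pow₀ hy1 two_ne_zero)
  obtain ⟨g, hgmax, hg1⟩ := exists_between (max_lt hr1 hq1)
  have hg0 : 0 < g := (hr0.trans (le_max_left _ _)).trans_lt hgmax
  refine ⟨d, -Real.logb 2 g, hd, neg_pos.2 (Real.logb_neg one_lt_two hg0 hg1), ?_⟩
  rintro k hk hk4
  have hev := (eventually_two_mul_pow_add_le_pow (l := l) (by positivity) hr0
    ((le_max_right _ _).trans_lt hgmax) ((le_max_left _ _).trans_lt hgmax)).and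
    ((tendsto_pow_atTop_atTop_of_one_lt hy1).eventually_ge_atTop
      (2 * ((k / 2 + 1 : ℕ) * k ^ k : ℝ)))
  obtain ⟨n₀, hn₀⟩ := Filter.eventually_atTop.1 hev
  refine ⟨n₀, fun n hn b hb Ω _ μ hμ hμ1 U hU hUQ => ?_⟩
  obtain ⟨hdecay, hCy⟩ := hn₀ n hn
  have hcard : (Fintype.card (Fin (2 ^ b)) : ℝ) = (c * y ^ 8) ^ n := by
    rw [Fintype.card_fin, Nat.cast_pow, Nat.cast_ofNat, ← Real.rpow_natCast, hb, ← hR,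
      Real.rpow_mul_natCast two_pos.le]
  have hcn : 0 < c ^ n := pow_pos (one_pos.trans hc1) n
  have hYn : 1 ≤ y ^ n := one_le_pow₀ hy1.le
  have hWc : (Fintype.card (Fin (2 ^ b)) : ℝ) * (1 / c ^ n) = (y ^ n) ^ 8 := by
    rw [hcard, mul_pow, pow_right_comm y 8 n]
    field_simp
  have hWm : (y ^ n) ^ 4 ≤ (Fintype.card (Fin (2 ^ b)) : ℝ) * r ^ n := by
    rw [hcard, ← mul_pow, ← pow_mul, mul_comm n 4, pow_mul]
    refine pow_le_pow_left₀ (by positivity) ?_ n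
    calc y ^ 4 = c * y ^ 8 * (c * y ^ 4)⁻¹ := by field_simp
      _ ≤ c * y ^ 8 * r := by gcongr; exact le_max_right _ _
  have hη : ((y ^ 2)⁻¹) ^ n = ((y ^ n) ^ 2)⁻¹ := by
    rw [inv_pow, ← pow_mul, ← pow_mul, mul_comm]
  have key := pr_relEnt_gt_le (η := ((y ^ 2)⁻¹) ^ n) (c := c ^ n) (m := r ^ n)
    (L := 1 + n * l) (p := fun u : Fin n → 𝒰 => ∏ j, QU (u j))
    (K := fun u (v : Fin n → 𝒱) => ∏ j, QVU (u j) (v j))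
    (Q := fun v : Fin n → 𝒱 => ∏ j, (∑ u, QU u * QVU u (v j)))
    hμ hk hU hUQ (fun u => Finset.prod_nonneg fun j _ => hQU0 _)
    (by rw [← Fintype.prod_sum fun (_ : Fin n) u => QU u]; simp [hQU1])
    (fun u v => Finset.prod_nonneg fun j _ => hQVU0 _ _)
    (fun u => by rw [← Fintype.prod_sum fun j v => QVU (u j) v]; simp [hQVU1])
    (fun v => by
      simp only [← Finset.prod_mul_distrib]
      exact Fintype.prod_sum fun j u => QU u * QVU u (v j))
    hcn (by positivity) (pow_le_one₀ (by positivity) hq1.le) (by positivity)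
    ((htail n).trans (pow_le_pow_left₀ hθ0 (le_max_left _ _) n))
    (fun v hv => hl n v hv) (hWc ▸ one_le_pow₀ hYn) ((one_le_pow₀ hYn).trans hWm)
  have hγ₁ : (2 : ℝ) ^ (-(-Real.logb 2 g * n)) = g ^ n := by
    rw [neg_mul, neg_neg, Real.rpow_mul_natCast two_pos.le,
      Real.rpow_logb two_pos (by norm_num) hg0]
  have h𝒱 : (1 : ℝ) ≤ Fintype.card 𝒱 := by
    rw [Nat.one_le_cast, Nat.one_le_iff_ne_zero]
    intro h
    have := Fintype.card_eq_zero_iff.1 h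
    simp only [Finset.univ_eq_empty, Finset.sum_empty, zero_ne_one] at hQVU1
    have := isEmpty_iff.2 hQVU1
    simp at hQU1
  have hγ₀ : (2 : ℝ) ^ ((-(k : ℝ) * d + Real.logb 2 (Fintype.card 𝒱)) * n) =
      (Fintype.card 𝒱 : ℝ) ^ n / (y ^ n) ^ k := by
    rw [Real.rpow_mul_natCast two_pos.le, Real.rpow_add two_pos,
      Real.rpow_logb two_pos (by norm_num) (by linarith), neg_mul, Real.rpow_neg two_pos.le,
      mul_comm (k : ℝ) d, Real.rpow_mul_natCast two_pos.le, mul_pow, inv_pow, ← pow_mul,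
      ← pow_mul, mul_comm n k]
    ring
  rw [hγ₁, hγ₀]
  refine (pr_mono hμ fun ω hω => ?_).trans (key.trans ?_)
  · have h2b : (Fintype.card (Fin (2 ^ b)) : ℝ) = 2 ^ b := by simp
    rw [h2b]
    exact hdecay.trans_lt hω
  · obtain ⟨h, rfl⟩ := hk.two_dvd
    rw [hWc, hη, Fintype.card_fun, Fintype.card_fin, Nat.cast_pow]
    have := mul_div_add_div_le (h := h) (by omega) (one_le_pow₀ h𝒱 (n := n))
      (by positivity) hYn hCy hWm
    simpa using this
end

section
/- Let W be a finite index set of size N = |W|, and let {T_w}_{w ∈ W} be random variables taking values in [0,1]. Define T = Σ_{w ∈ W} T_w and μ = E[T]. Let τ > 0 and set k* = ⌈ μτ / (1 − μ/N) ⌉. If the variables {T_w} are k-wise independent for some integer k ≥ k*, then Pr[ T ≥ μ(1+τ) ] ≤ C(N, k*) (μ/N)^{k*} / C(μ(1+τ), k*), where C(N,k*) is the ordinary binomial coefficient and C(μ(1+τ), k*) = μ(1+τ)·(μ(1+τ)−1)⋯(μ(1+τ)−k*+1)/k*! is the generalized binomial coefficient of the real number μ(1+τ). -/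
open Finset
open scoped Classical

/-- Generalized binomial coefficient `C(x,k) = x(x−1)⋯(x−k+1)/k!` of a real `x`. -/
noncomputable def genChoose (x : ℝ) (k : ℕ) : ℝ :=
  (∏ i ∈ Finset.range k, (x - i)) / (k.factorial : ℝ)

/-- The `k`-th elementary symmetric function of a finite real family. -/
noncomputable def elemSymm {W : Type*} [Fintype W] (x : W → ℝ) (k : ℕ) : ℝ :=
  ∑ I ∈ powersetCard k (univ : Finset W), ∏ w ∈ I, x w

section ElemSymm

variable {W : Type*} [Fintype W]

theorem elemSymm_zero (x : W → ℝ) : elemSymm x 0 = 1 := by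
  simp [elemSymm]

theorem elemSymm_nonneg {x : W → ℝ} (hx : ∀ w, 0 ≤ x w) (k : ℕ) : 0 ≤ elemSymm x k :=
  sum_nonneg fun _ _ => prod_nonneg fun w _ => hx w

theorem succ_mul_elemSymm_succ (x : W → ℝ) (k : ℕ) :
    (k + 1 : ℝ) * elemSymm x (k + 1) =
      ∑ I ∈ powersetCard k (univ : Finset W), (∏ w ∈ I, x w) * ∑ i ∈ Iᶜ, x i := by
  have h : (k + 1 : ℝ) * elemSymm x (k + 1) =
      ∑ J ∈ powersetCard (k + 1) (univ : Finset W), ∑ _i ∈ J, ∏ w ∈ J, x w := by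
    rw [elemSymm, mul_sum]
    refine sum_congr rfl fun J hJ => ?_
    rw [sum_const, (mem_powersetCard.1 hJ).2, nsmul_eq_mul]
    push_cast
    rfl
  simp_rw [h, mul_sum]
  rw [sum_sigma', sum_sigma']
  refine sum_bij' (fun p _ => ⟨p.1.erase p.2, p.2⟩) (fun p _ => ⟨insert p.2 p.1, p.2⟩)
    ?_ ?_ ?_ ?_ ?_
  · rintro ⟨J, i⟩ h
    simp only [mem_sigma, mem_powersetCard_univ] at h
    simp [card_erase_of_mem h.2, h.1]
  · rintro ⟨I, i⟩ h
    simp only [mem_sigma, mem_powersetCard_univ, mem_compl] at h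
    simp [card_insert_of_notMem h.2, h.1]
  · rintro ⟨J, i⟩ h
    simp only [mem_sigma] at h
    simp [insert_erase h.2]
  · rintro ⟨I, i⟩ h
    simp only [mem_sigma, mem_compl] at h
    simp [erase_insert h.2]
  · rintro ⟨J, i⟩ h
    simp only [mem_sigma] at h
    exact (prod_erase_mul J x h.2).symm

theorem sub_mul_elemSymm_le {x : W → ℝ} (hx : ∀ w, 0 ≤ x w ∧ x w ≤ 1) (k : ℕ) :
    (∑ w, x w - k) * elemSymm x k ≤ (k + 1 : ℝ) * elemSymm x (k + 1) := by
  rw [succ_mul_elemSymm_succ, elemSymm, mul_sum]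
  refine sum_le_sum fun I hI => ?_
  rw [mul_comm]
  refine mul_le_mul_of_nonneg_left ?_ (prod_nonneg fun w _ => (hx w).1)
  have h1 : ∑ i ∈ I, x i ≤ k := by
    calc ∑ i ∈ I, x i ≤ ∑ _i ∈ I, (1 : ℝ) := sum_le_sum fun i _ => (hx i).2
      _ = k := by simp [(mem_powersetCard.1 hI).2]
  linarith [sum_add_sum_compl I x]

theorem genChoose_succ (a : ℝ) (k : ℕ) :
    (k + 1 : ℝ) * genChoose a (k + 1) = (a - k) * genChoose a k := by
  have : (k.factorial : ℝ) ≠ 0 := by positivity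
  have : (k + 1 : ℝ) ≠ 0 := by positivity
  rw [genChoose, genChoose, prod_range_succ, Nat.factorial_succ]
  push_cast
  field_simp

theorem genChoose_pos {a : ℝ} {k : ℕ} (h : (k : ℝ) < a + 1) : 0 < genChoose a k := by
  refine div_pos (prod_pos fun i hi => ?_) (by positivity)
  have : (i + 1 : ℝ) ≤ k := by exact_mod_cast mem_range.1 hi
  linarith

theorem genChoose_le_elemSymm {x : W → ℝ} (hx : ∀ w, 0 ≤ x w ∧ x w ≤ 1) {a : ℝ}
    (ha : a ≤ ∑ w, x w) (k : ℕ) (hk : (k : ℝ) < a + 1) : genChoose a k ≤ elemSymm x k := by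
  induction k with
  | zero => simp [elemSymm_zero, genChoose]
  | succ k ih =>
    push_cast at hk
    have hpos : (0 : ℝ) < k + 1 := by positivity
    refine le_of_mul_le_mul_left ?_ hpos
    rw [genChoose_succ]
    refine le_trans ?_ (sub_mul_elemSymm_le hx k)
    exact mul_le_mul (by linarith) (ih (by linarith)) (genChoose_pos (by linarith)).le
      (by linarith)

theorem monovary_sum_prod_filter_mem {x : W → ℝ} (hx : ∀ w, 0 ≤ x w) (k : ℕ) :
    Monovary (fun i => ∑ I ∈ powersetCard k (univ : Finset W) with i ∈ I, ∏ w ∈ I, x w) x := by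
  intro i j hij
  have hswap : ∑ J ∈ powersetCard k (univ : Finset W) with j ∈ J, ∏ w ∈ J, x w =
      ∑ I ∈ powersetCard k (univ : Finset W) with i ∈ I, ∏ w ∈ I, x (Equiv.swap i j w) := by
    symm
    refine sum_equiv (Equiv.finsetCongr (Equiv.swap i j)) (fun I => ?_) (fun I _ => ?_)
    · simp [mem_map_equiv]
    · simp
  change _ ≤ ∑ J ∈ powersetCard k (univ : Finset W) with j ∈ J, ∏ w ∈ J, x w
  rw [hswap]
  refine sum_le_sum fun I hI => ?_
  have hi := (mem_filter.1 hI).2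
  by_cases hj : j ∈ I
  · refine (prod_equiv (Equiv.swap i j) (fun w => ?_) fun _ _ => rfl).ge
    by_cases h1 : w = i
    · simp [h1, hi, hj]
    · by_cases h2 : w = j
      · simp [h2, hi, hj]
      · rw [Equiv.swap_apply_of_ne_of_ne h1 h2]
  · refine prod_le_prod (fun w _ => hx w) fun w hw => ?_
    by_cases h1 : w = i
    · simpa [h1] using hij.le
    · rw [Equiv.swap_apply_of_ne_of_ne h1 (ne_of_mem_of_not_mem hw hj)]

theorem card_mul_succ_mul_elemSymm_succ_le {x : W → ℝ} (hx : ∀ w, 0 ≤ x w) (k : ℕ) :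
    (Fintype.card W : ℝ) * ((k + 1 : ℝ) * elemSymm x (k + 1)) ≤
      (Fintype.card W - k : ℝ) * (∑ w, x w) * elemSymm x k := by
  set g : W → ℝ := fun i => ∑ I ∈ powersetCard k (univ : Finset W) with i ∈ I, ∏ w ∈ I, x w
  have hdouble (y : W → ℝ) : ∑ i, g i * y i =
      ∑ I ∈ powersetCard k (univ : Finset W), (∏ w ∈ I, x w) * ∑ i ∈ I, y i := by
    simp_rw [g, sum_filter, sum_mul]
    rw [sum_comm]
    refine sum_congr rfl fun I _ => ?_
    simp [mul_sum, ite_mul]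
  have hg : ∑ i, g i = k * elemSymm x k := by
    have := hdouble fun _ => 1
    simp only [mul_one] at this
    rw [this, elemSymm, mul_sum]
    refine sum_congr rfl fun I hI => ?_
    simp [(mem_powersetCard.1 hI).2, mul_comm]
  have hcheb := (monovary_sum_prod_filter_mem hx k).sum_mul_sum_le_card_mul_sum
  change (∑ i, g i) * _ ≤ _ * ∑ i, g i * x i at hcheb
  have hrec : (k + 1 : ℝ) * elemSymm x (k + 1) =
      (∑ w, x w) * elemSymm x k - ∑ i, g i * x i := by
    rw [succ_mul_elemSymm_succ, hdouble, elemSymm, mul_sum, ← sum_sub_distrib]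
    refine sum_congr rfl fun I _ => ?_
    rw [← sum_add_sum_compl I x]
    ring
  rw [hg] at hcheb
  rw [hrec]
  linarith

/-- **Maclaurin's inequality** comparing the `k`-th elementary symmetric mean with the first. -/
theorem elemSymm_le_choose_mul_pow {x : W → ℝ} (hx : ∀ w, 0 ≤ x w) (k : ℕ) :
    elemSymm x k ≤
      ((Fintype.card W).choose k : ℝ) * ((∑ w, x w) / (Fintype.card W : ℝ)) ^ k := by
  induction k with
  | zero => simp [elemSymm_zero]
  | succ k ih =>
    rcases lt_or_ge k (Fintype.card W) with hk | hk
    · have hN : (0 : ℝ) < Fintype.card W := by exact_mod_cast Nat.zero_lt_of_lt hk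
      have hkN : (k : ℝ) ≤ Fintype.card W := by exact_mod_cast hk.le
      have hs : 0 ≤ ∑ w, x w := sum_nonneg fun w _ => hx w
      have hpos : (0 : ℝ) < Fintype.card W * (k + 1) := by positivity
      have hchoose : ((Fintype.card W).choose (k + 1) : ℝ) * (k + 1) =
          (Fintype.card W).choose k * (Fintype.card W - k) := by
        have := Nat.choose_succ_right_eq (Fintype.card W) k
        rw [← Nat.cast_sub hk.le]
        exact_mod_cast this
      refine le_of_mul_le_mul_left ?_ hpos
      rw [mul_assoc]
      refine (card_mul_succ_mul_elemSymm_succ_le hx k).trans ?_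
      refine (mul_le_mul_of_nonneg_left ih (mul_nonneg (by linarith) hs)).trans_eq ?_
      rw [pow_succ]
      calc _ = (((Fintype.card W).choose k : ℝ) * (Fintype.card W - k)) *
            ((∑ w, x w) / Fintype.card W) ^ k * (∑ w, x w) := by ring
        _ = _ := by
          rw [← hchoose]
          field_simp
    · rw [elemSymm, powersetCard_eq_empty.2 (by rw [card_univ]; omega), sum_empty]
      have := sum_nonneg fun w (_ : w ∈ univ) => hx w
      positivity

end ElemSymm

section KWiseIndep

variable {Ω W : Type*} [Fintype Ω]

/-- The expectation of a random variable is the sum of its values weighted by probability. -/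
theorem sum_mul_pr_eq {α : Type*} (μ : Ω → ℝ) (X : Ω → α) (g : α → ℝ) {V : Finset α}
    (hV : ∀ ω, X ω ∈ V) :
    ∑ v ∈ V, g v * pr μ (fun ω => X ω = v) = ∑ ω, μ ω * g (X ω) := by
  simp_rw [pr, sum_filter, mul_sum]
  rw [sum_comm]
  refine sum_congr rfl fun ω _ => ?_
  simp [hV ω, mul_comm]

/-- Expectations of products over at most `k` variables factor under `k`-wise independence. -/
theorem kWiseIndep.sum_mul_prod {μ : Ω → ℝ} {T : W → Ω → ℝ} {k : ℕ} (h : kWiseIndep μ T k)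
    {S : Finset W} (hS : S.card ≤ k) :
    ∑ ω, μ ω * ∏ w ∈ S, T w ω = ∏ w ∈ S, ∑ ω, μ ω * T w ω := by
  set V : Finset ℝ := S.biUnion fun w => univ.image (T w)
  have hV (w : S) (ω : Ω) : T w ω ∈ V :=
    mem_biUnion.2 ⟨w, w.2, mem_image_of_mem _ (mem_univ ω)⟩
  have hindep (p : S → ℝ) : ∏ w : S, pr μ (fun ω => T w ω = p w) =
      pr μ (fun ω => (fun w : S => T w ω) = p) := by
    have := h S hS fun w => if hw : w ∈ S then p ⟨w, hw⟩ else 0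
    rw [← prod_coe_sort] at this
    simp only [coe_mem, dite_true, Subtype.coe_eta] at this
    rw [← this]
    congr 1
    ext ω
    rw [funext_iff, Subtype.forall]
    refine forall₂_congr fun w hw => ?_
    simp [hw]
  symm
  calc ∏ w ∈ S, ∑ ω, μ ω * T w ω
      = ∏ w : S, ∑ v ∈ V, v * pr μ (fun ω => T w ω = v) := by
        rw [← prod_coe_sort]
        exact prod_congr rfl fun w _ => (sum_mul_pr_eq μ (T w) id (hV w)).symm
    _ = ∑ p ∈ Fintype.piFinset fun _ : S => V,
          (∏ w, p w) * pr μ (fun ω => (fun w : S => T w ω) = p) := by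
        rw [prod_univ_sum]
        refine sum_congr rfl fun p _ => ?_
        rw [prod_mul_distrib, hindep]
    _ = ∑ ω, μ ω * ∏ w : S, T w ω :=
        sum_mul_pr_eq μ (fun ω (w : S) => T w ω) (fun p => ∏ w, p w)
          fun ω => Fintype.mem_piFinset.2 fun w => hV w ω
    _ = ∑ ω, μ ω * ∏ w ∈ S, T w ω :=
        sum_congr rfl fun ω _ => by rw [prod_coe_sort S fun w => T w ω]

theorem kWiseIndep.sum_mul_elemSymm [Fintype W] {μ : Ω → ℝ} {T : W → Ω → ℝ} {k : ℕ}
    (h : kWiseIndep μ T k) {j : ℕ} (hj : j ≤ k) :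
    ∑ ω, μ ω * elemSymm (fun w => T w ω) j = elemSymm (fun w => ∑ ω, μ ω * T w ω) j := by
  simp_rw [elemSymm, mul_sum]
  rw [sum_comm]
  exact sum_congr rfl fun I hI => h.sum_mul_prod ((mem_powersetCard.1 hI).2.trans_le hj)

/-- **Markov's inequality** on a finite space. -/
theorem mul_pr_le_sum {μ : Ω → ℝ} (hμ : ∀ ω, 0 ≤ μ ω) {E : Ω → Prop} {f : Ω → ℝ}
    (hf : ∀ ω, 0 ≤ f ω) {c : ℝ} (hE : ∀ ω, E ω → c ≤ f ω) :
    c * pr μ E ≤ ∑ ω, μ ω * f ω := by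
  rw [pr, mul_sum, sum_filter]
  refine sum_le_sum fun ω _ => ?_
  split_ifs with h
  · rw [mul_comm]
    exact mul_le_mul_of_nonneg_left (hE ω h) (hμ ω)
  · exact mul_nonneg (hμ ω) (hf ω)

end KWiseIndep

/-- Concentration bound of Schmidt, Siegel and Srinivasan for sums of `k`-wise
independent `[0,1]`-valued random variables: if `k ≥ k* = ⌈μτ/(1−μ/N)⌉` then
`Pr[T ≥ μ(1+τ)] ≤ C(N,k*)(μ/N)^{k*} / C(μ(1+τ),k*)`. -/
theorem schmidt_siegel_srinivasan_concentration
    {Ω W : Type*} [Fintype Ω] [Fintype W]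
    (μ : Ω → ℝ) (hμ0 : ∀ ω, 0 ≤ μ ω) (hμ1 : ∑ ω, μ ω = 1)
    (T : W → Ω → ℝ) (hT : ∀ w ω, 0 ≤ T w ω ∧ T w ω ≤ 1)
    (μT : ℝ) (hμT : μT = ∑ ω, μ ω * ∑ w, T w ω)
    (τ : ℝ) (hτ : 0 < τ)
    (kstar : ℕ) (hkstar : kstar = ⌈μT * τ / (1 - μT / (Fintype.card W : ℝ))⌉₊)
    (k : ℕ) (hk : kstar ≤ k)
    (hindep : kWiseIndep μ T k) :
    pr μ (fun ω => μT * (1 + τ) ≤ ∑ w, T w ω) ≤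
      ((Fintype.card W).choose kstar : ℝ) * (μT / (Fintype.card W : ℝ)) ^ kstar
        / genChoose (μT * (1 + τ)) kstar := by
  have hmean : ∑ w, ∑ ω, μ ω * T w ω = μT := by
    rw [hμT, sum_comm]
    simp_rw [mul_sum]
  have hμT0 : 0 ≤ μT := by
    rw [← hmean]
    exact sum_nonneg fun w _ => sum_nonneg fun ω _ => mul_nonneg (hμ0 ω) (hT w ω).1
  have hsum_le (ω : Ω) : ∑ w, T w ω ≤ Fintype.card W := by
    calc ∑ w, T w ω ≤ ∑ _w : W, (1 : ℝ) := sum_le_sum fun w _ => (hT w ω).2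
      _ = Fintype.card W := by simp
  rcases le_or_gt (μT * (1 + τ)) (Fintype.card W) with ha | ha
  · have hlt : (kstar : ℝ) < μT * (1 + τ) + 1 := by
      have hratio : μT * τ / (1 - μT / (Fintype.card W : ℝ)) ≤ μT * (1 + τ) := by
        rcases hμT0.eq_or_lt with h0 | h0
        · simp [← h0]
        have hpos : 0 < μT * τ := mul_pos h0 hτ
        have hN : (0 : ℝ) < Fintype.card W := by linarith
        have hden : 0 < 1 - μT / (Fintype.card W : ℝ) := by
          rw [sub_pos, div_lt_one hN]
          linarith
        have hfrac : μT * (1 + τ) / (Fintype.card W : ℝ) ≤ 1 := (div_le_one hN).2 ha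
        rw [div_le_iff₀ hden]
        have := mul_le_mul_of_nonneg_left hfrac hμT0
        linear_combination this
      have ha0 : 0 ≤ μT * (1 + τ) := by positivity
      rw [hkstar]
      exact (Nat.cast_le.2 (Nat.ceil_mono hratio)).trans_lt (Nat.ceil_lt_add_one ha0)
    have hpos := genChoose_pos hlt
    rw [le_div_iff₀ hpos, mul_comm]
    calc genChoose (μT * (1 + τ)) kstar * pr μ (fun ω => μT * (1 + τ) ≤ ∑ w, T w ω)
        ≤ ∑ ω, μ ω * elemSymm (fun w => T w ω) kstar :=
          mul_pr_le_sum hμ0 (fun ω => elemSymm_nonneg (fun w => (hT w ω).1) kstar)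
            fun ω hω => genChoose_le_elemSymm (fun w => hT w ω) hω kstar hlt
      _ = elemSymm (fun w => ∑ ω, μ ω * T w ω) kstar := hindep.sum_mul_elemSymm hk
      _ ≤ _ := by
          rw [← hmean]
          exact elemSymm_le_choose_mul_pow
            (fun w => sum_nonneg fun ω _ => mul_nonneg (hμ0 ω) (hT w ω).1) kstar
  · have hpr : pr μ (fun ω => μT * (1 + τ) ≤ ∑ w, T w ω) = 0 := by
      rw [pr, filter_false_of_mem fun ω _ => not_le.2 ((hsum_le ω).trans_lt ha), sum_empty]
    rw [hpr]
    rcases lt_or_ge (Fintype.card W) kstar with hN | hN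
    · simp [Nat.choose_eq_zero_of_lt hN]
    · have hN' : (kstar : ℝ) ≤ Fintype.card W := by exact_mod_cast hN
      have := genChoose_pos (a := μT * (1 + τ)) (k := kstar) (by linarith)
      positivity
end

section
/- Let p ∈ (0,1/2) and r ∈ [0,1] with r < 1 − H₂(p), let R' > r and R + R' < 1 − H₂(p), with Rn, R'n, rn, pn integers. For every sufficiently large (but fixed) positive integer k and every δ > 0, there exists γ₂ > 0 such that for all sufficiently large n and every message m ∈ {0,1}^{Rn} the following holds. Let 𝒞_n be a random [n,Rn,R'n] pseudolinear code obtained by fixing a map h : {0,1}^{Rn} × {0,1}^{R'n} → GF(2)^ℓ whose images of distinct nonzero inputs are distinct nonzero vectors with any k of them linearly independent over GF(2), and drawing G uniformly from GF(2)^{ℓ×n}, with codewords x(m,w) = h(m,w)G. Let P_error^{(m)}(𝒞_n) be the maximum, over all sets S ⊆ {1,…,n} with |S| = rn and all maps e : {0,1}^{rn} → {0,1}^n assigning to each observation an error vector of Hamming weight at most pn, of the probability (over W uniform on {0,1}^{R'n}) that minimum-distance decoding of x(m,W) + e(x(m,W,S)) returns a message different from m. Then Pr_{𝒞_n}[ P_error^{(m)}(𝒞_n)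 > δ ] ≤ 2^{−kγ₂ n}. -/
open Finset
open scoped Classical

/-- Binary entropy function (base-2 logarithms). -/
noncomputable def H2 (x : ℝ) : ℝ := -(x * Real.logb 2 x) - (1 - x) * Real.logb 2 (1 - x)

/-- The number of binary words of length `n` and Hamming weight at most `t`. -/
noncomputable def hammingBallCard (n t : ℕ) : ℕ :=
  #{x : Fin n → ZMod 2 | hammingNorm x ≤ t}

theorem card_filter_hammingDist_le {n : ℕ} (t : ℕ) (u : Fin n → ZMod 2) :
    #{x : Fin n → ZMod 2 | hammingDist x u ≤ t} = hammingBallCard n t := by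
  refine card_bij (fun x _ => -x + u) ?_ ?_ ?_
  · intro x hx
    simpa [hammingDist_eq_hammingNorm] using hx
  · intro x _ y _ hxy
    simpa using hxy
  · intro y hy
    exact ⟨u - y, by simpa [hammingDist_eq_hammingNorm] using hy, by simp⟩

theorem sum_prod_bernoulli_weights (n : ℕ) (p : ℝ) :
    ∑ x : Fin n → ZMod 2, ∏ i, (if x i ≠ 0 then p else 1 - p) = 1 := by
  rw [← Fintype.piFinset_univ,
    ← Finset.prod_univ_sum (fun _ : Fin n => (univ : Finset (ZMod 2)))
      (fun _ y => if y ≠ 0 then p else 1 - p)]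
  refine prod_eq_one fun i _ => ?_
  have : (univ : Finset (ZMod 2)) = {0, 1} := by decide
  rw [this, sum_pair (by decide)]
  simp

theorem prod_bernoulli_weights {n : ℕ} (p : ℝ) (x : Fin n → ZMod 2) :
    ∏ i, (if x i ≠ 0 then p else 1 - p) =
      p ^ hammingNorm x * (1 - p) ^ (n - hammingNorm x) := by
  rw [prod_ite, prod_const, prod_const, ← hammingNorm, filter_not,
    card_sdiff_of_subset (filter_subset _ _), card_univ, Fintype.card_fin, ← hammingNorm]

theorem hammingBallCard_le {n t : ℕ} {p : ℝ} (hp0 : 0 < p) (hp1 : p < 1 / 2)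
    (ht : (t : ℝ) = p * n) : (hammingBallCard n t : ℝ) ≤ 2 ^ (H2 p * n) := by
  have h1p : 0 < 1 - p := by linarith
  have htn : t ≤ n := by
    have : (t : ℝ) ≤ n := by rw [ht]; nlinarith [(Nat.cast_nonneg n : (0 : ℝ) ≤ n)]
    exact_mod_cast this
  have hterm : ∀ x : Fin n → ZMod 2, hammingNorm x ≤ t →
      p ^ t * (1 - p) ^ (n - t) ≤ ∏ i, (if x i ≠ 0 then p else 1 - p) := by
    intro x hx
    rw [prod_bernoulli_weights]
    obtain ⟨d, rfl⟩ := Nat.exists_eq_add_of_le hx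
    have h2 : n - hammingNorm x = d + (n - (hammingNorm x + d)) := by omega
    rw [h2, pow_add, pow_add, mul_assoc]
    gcongr
    linarith
  have hsum : (hammingBallCard n t : ℝ) * (p ^ t * (1 - p) ^ (n - t)) ≤ 1 := by
    calc (hammingBallCard n t : ℝ) * (p ^ t * (1 - p) ^ (n - t))
        = ∑ x : Fin n → ZMod 2 with hammingNorm x ≤ t, p ^ t * (1 - p) ^ (n - t) := by
          rw [sum_const, nsmul_eq_mul, hammingBallCard]
      _ ≤ ∑ x : Fin n → ZMod 2 with hammingNorm x ≤ t, ∏ i, (if x i ≠ 0 then p else 1 - p) :=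
          sum_le_sum fun x hx => hterm x (mem_filter.1 hx).2
      _ ≤ ∑ x : Fin n → ZMod 2, ∏ i, (if x i ≠ 0 then p else 1 - p) :=
          sum_le_sum_of_subset_of_nonneg (subset_univ _) fun x _ _ =>
            prod_nonneg fun i _ => by split_ifs <;> linarith
      _ = 1 := sum_prod_bernoulli_weights n p
  have hweight : p ^ t * (1 - p) ^ (n - t) = (2 : ℝ) ^ (-(H2 p * n)) := by
    rw [← Real.rpow_natCast, ← Real.rpow_natCast, Nat.cast_sub htn, ht]
    have h2 : ∀ x : ℝ, 0 < x → ∀ y : ℝ, x ^ y = 2 ^ (Real.logb 2 x * y) := fun x hx y => by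
      rw [Real.rpow_mul (by norm_num), Real.rpow_logb (by norm_num) (by norm_num) hx]
    rw [h2 p hp0, h2 (1 - p) h1p, ← Real.rpow_add (by norm_num)]
    congr 1
    unfold H2
    ring
  rw [hweight, Real.rpow_neg (by norm_num), ← div_eq_mul_inv, div_le_one (by positivity)] at hsum
  exact hsum

theorem exists_matrix_vecMul_eq {K ι κ ν : Type*} [Field K] [Fintype ι] [Fintype κ]
    (v : ι → κ → K) (hv : LinearIndependent K v) (y : ι → ν → K) :
    ∃ G : Matrix κ ν K, ∀ i, Matrix.vecMul (v i) G = y i := by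
  obtain ⟨g, hg⟩ := LinearMap.exists_leftInverse_of_injective _
    (LinearMap.ker_eq_bot.2 hv)
  refine ⟨fun c d => (Finsupp.linearCombination K y (g (Pi.single c 1))) d, fun i => ?_⟩
  have hvi : g (v i) = Finsupp.single i 1 := by
    have := LinearMap.congr_fun hg (Finsupp.single i 1)
    simpa using this
  have hdecomp : v i = ∑ c, v i c • Pi.single c (1 : K) := by
    ext d
    simp [Finset.sum_apply, Pi.single_apply]
  have hy : Finsupp.linearCombination K y (g (v i)) = y i := by simp [hvi]
  rw [hdecomp, map_sum, map_sum] at hy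
  ext d
  have := congrFun hy d
  simp only [map_smul, Finset.sum_apply, Pi.smul_apply, smul_eq_mul] at this
  rw [← this]
  rfl

theorem card_filter_vecMul_mul {ι : Type*} [Fintype ι] {ℓ n : ℕ} (v : ι → Fin ℓ → ZMod 2)
    (hv : LinearIndependent (ZMod 2) v) (P : (ι → Fin n → ZMod 2) → Prop) {N : ℕ}
    (hN : #{y : ι → Fin n → ZMod 2 | P y} = N) :
    #{G : Matrix (Fin ℓ) (Fin n) (ZMod 2) | P fun i => Matrix.vecMul (v i) G} *
        2 ^ (n * Fintype.card ι) =
      N * Fintype.card (Matrix (Fin ℓ) (Fin n) (ZMod 2)) := by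
  let φ : Matrix (Fin ℓ) (Fin n) (ZMod 2) →+ (ι → Fin n → ZMod 2) :=
    { toFun := fun G i => Matrix.vecMul (v i) G
      map_zero' := by ext; simp
      map_add' := fun A B => by ext; simp [Matrix.vecMul_add] }
  have hφ : ∀ y, y ∈ Set.range φ := fun y => by
    obtain ⟨G, hG⟩ := exists_matrix_vecMul_eq v hv y
    exact ⟨G, funext hG⟩
  have hfib : ∀ y, #{G | φ G = y} = #{G | φ G = 0} := fun y =>
    AddMonoidHom.card_fiber_eq_of_mem_range φ (hφ y) (hφ 0)
  have hcount : ∀ Q : (ι → Fin n → ZMod 2) → Prop,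
      #{G | Q (φ G)} = #{y | Q y} * #{G | φ G = 0} := by
    intro Q
    rw [card_eq_sum_card_fiberwise (f := φ) (t := {y | Q y}) (by intro G hG; simpa using hG),
      ← smul_eq_mul, ← sum_const]
    refine sum_congr rfl fun y hy => ?_
    rw [← hfib y, filter_filter]
    congr 1
    ext G
    simp only [mem_filter, mem_univ, true_and] at hy ⊢
    exact ⟨fun h => h.2, fun h => ⟨h ▸ hy, h⟩⟩
  have htot := hcount fun _ => True
  have hcard : Fintype.card (ι → Fin n → ZMod 2) = 2 ^ (n * Fintype.card ι) := by
    simp [pow_mul, ZMod.card]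
  simp only [filter_true, card_univ, hcard] at htot
  rw [htot]
  change #{G | P (φ G)} * _ = _
  rw [hcount P, hN]
  ring

theorem card_mul_mul_le_of_double_count {α β : Type*} [Fintype α] (A : Finset α) (B : Finset β)
    (r : α → β → Prop) {κ N C : ℝ} (hN : 0 ≤ N)
    (hA : ∀ a ∈ A, κ ≤ #{b ∈ B | r a b}) (hB : ∀ b ∈ B, (#{a | r a b} : ℝ) * N ≤ C) :
    #A * κ * N ≤ #B * C := by
  have hswap : (∑ a ∈ A, (#{b ∈ B | r a b} : ℝ)) = ∑ b ∈ B, (#{a ∈ A | r a b} : ℝ) := by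
    exact_mod_cast sum_card_bipartiteAbove_eq_sum_card_bipartiteBelow r
  calc #A * κ * N ≤ (∑ a ∈ A, (#{b ∈ B | r a b} : ℝ)) * N := by
        gcongr
        rw [← nsmul_eq_mul]
        exact card_nsmul_le_sum _ _ _ hA
    _ = ∑ b ∈ B, (#{a ∈ A | r a b} : ℝ) * N := by rw [hswap, sum_mul]
    _ ≤ #B * C := by
        rw [← nsmul_eq_mul]
        refine sum_le_card_nsmul _ _ _ fun b hb => le_trans ?_ (hB b hb)
        gcongr
        exact subset_univ A

theorem exists_many_matchings {W Q : Type*} [Fintype W] [Fintype Q] (B : Finset W)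
    (r : W → Q → Prop) (j : ℕ) (hB : ∀ w ∈ B, ∃ q, r w q)
    (hfib : ∀ q, #{w ∈ B | r w q} ≤ j) :
    ∃ D : ℕ, #B ≤ j * D ∧ (D + 1 - j) ^ j ≤
      #{f : Fin j → W × Q | (fun i => (f i).1).Injective ∧ (fun i => (f i).2).Injective ∧
        ∀ i, (f i).1 ∈ B ∧ r (f i).1 (f i).2} := by
  rcases isEmpty_or_nonempty Q with hQ | hQ
  · have hB0 : B = ∅ := eq_empty_of_forall_notMem fun w hw => hQ.elim (hB w hw).choose
    refine ⟨0, by simp [hB0], ?_⟩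
    rcases j.eq_zero_or_pos with rfl | hj
    · simp [hB0, Function.Injective]
    · rw [zero_add, Nat.sub_eq_zero_of_le hj, zero_pow hj.ne']
      exact Nat.zero_le _
  choose! φ hφ using hB
  have hcard : #B ≤ j * #(B.image φ) := by
    refine card_le_mul_card_image B j fun q _ => (card_le_card fun w hw => ?_).trans (hfib q)
    rw [mem_filter] at hw ⊢
    exact ⟨hw.1, hw.2 ▸ hφ w hw.1⟩
  obtain ⟨E, hEB, hE, hEim⟩ := exists_subset_injOn_image_eq_of_surjOn B (B.image φ)
    (f := φ) (by rw [coe_image]; exact Set.surjOn_image _ _)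
  have hEcard : #E = #(B.image φ) := by rw [← hEim, card_image_of_injOn hE]
  refine ⟨#E, by rwa [hEcard], (Nat.pow_sub_le_descFactorial _ _).trans ?_⟩
  have hemb : Fintype.card (Fin j ↪ E) = (#E).descFactorial j := by
    rw [Fintype.card_embedding_eq, Fintype.card_fin, Fintype.card_coe]
  rw [← hemb, ← card_univ]
  refine card_le_card_of_injOn (fun g i => ((g i : W), φ (g i))) ?_ ?_
  · intro g _
    simp only [coe_filter, mem_univ, true_and, Set.mem_ofPred_eq]
    refine ⟨fun i i' h => g.injective (Subtype.ext h),
      fun i i' h => g.injective (Subtype.ext (hE (g i).2 (g i').2 h)), fun i => ?_⟩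
    exact ⟨hEB (g i).2, hφ _ (hEB (g i).2)⟩
  · intro g _ g' _ h
    exact DFunLike.ext _ _ fun i => Subtype.ext (congrArg Prod.fst (congrFun h i))

theorem card_filter_forall {j : ℕ} {X : Type*} [Fintype X] (P : X → Prop)
    [DecidablePred P] [DecidablePred fun y : Fin j → X => ∀ i, P (y i)] :
    #{y : Fin j → X | ∀ i, P (y i)} = #{x | P x} ^ j := by
  have h : ({y : Fin j → X | ∀ i, P (y i)} : Finset _) =
      Fintype.piFinset fun _ => ({x | P x} : Finset X) := by
    ext y
    simp
  rw [h, Fintype.card_piFinset, prod_const, card_univ, Fintype.card_fin]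

theorem card_filter_forall_sum {j : ℕ} {X : Type*} [Fintype X] (P : X → X → Prop)
    [DecidablePred fun x : X × X => P x.1 x.2]
    [DecidablePred fun y : Fin j ⊕ Fin j → X => ∀ i, P (y (.inl i)) (y (.inr i))] :
    #{y : Fin j ⊕ Fin j → X | ∀ i, P (y (.inl i)) (y (.inr i))} =
      #{x : X × X | P x.1 x.2} ^ j := by
  rw [← card_filter_forall]
  refine card_bij (fun y _ i => (y (.inl i), y (.inr i))) ?_ ?_ ?_
  · intro y hy
    simpa using hy
  · intro y _ y' _ h
    ext (i | i)
    · exact congrArg Prod.fst (congrFun h i)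
    · exact congrArg Prod.snd (congrFun h i)
  · intro y hy
    exact ⟨Sum.elim (fun i => (y i).1) (fun i => (y i).2), by simpa using hy, rfl⟩

theorem card_filter_agree_mul {n : ℕ} (S : Finset (Fin n)) (z : Fin n → ZMod 2) :
    #{x : Fin n → ZMod 2 | ∀ c ∈ S, x c = z c} * 2 ^ #S = 2 ^ n := by
  have h : ({x : Fin n → ZMod 2 | ∀ c ∈ S, x c = z c} : Finset _) =
      Fintype.piFinset fun c => if c ∈ S then {z c} else univ := by
    ext x
    simp only [mem_filter, mem_univ, true_and, Fintype.mem_piFinset]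
    refine forall_congr' fun c => ?_
    by_cases hc : c ∈ S <;> simp [hc]
  have hc : ∀ c, #(if c ∈ S then {z c} else (univ : Finset (ZMod 2))) *
      (if c ∈ S then 2 else 1) = 2 := by
    intro c
    by_cases hc : c ∈ S <;> simp [hc, ZMod.card]
  have hS : ∏ c, (if c ∈ S then 2 else 1) = 2 ^ #S := by
    rw [prod_ite_mem, univ_inter, prod_const]
  rw [h, Fintype.card_piFinset, ← hS, ← prod_mul_distrib, prod_congr rfl fun c _ => hc c]
  simp

theorem card_filter_agree_and_close_mul {n : ℕ} (t : ℕ) (S : Finset (Fin n))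
    (z e : Fin n → ZMod 2) :
    #{x : (Fin n → ZMod 2) × (Fin n → ZMod 2) |
        (∀ c ∈ S, x.1 c = z c) ∧ hammingDist x.2 (x.1 + e) ≤ t} * 2 ^ #S =
      2 ^ n * hammingBallCard n t := by
  rw [← card_filter_agree_mul S z, mul_right_comm]
  congr 1
  rw [card_eq_sum_card_fiberwise (f := Prod.fst) (t := {x | ∀ c ∈ S, x c = z c})
    (by intro x hx; simp only [coe_filter, mem_univ, true_and, Set.mem_ofPred_eq] at hx ⊢
        exact hx.1), ← smul_eq_mul, ← sum_const]
  refine sum_congr rfl fun x hx => ?_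
  rw [← card_filter_hammingDist_le t (x + e)]
  refine card_bij (fun y _ => y.2) ?_ ?_ ?_
  · rintro ⟨y₁, y₂⟩ hy
    simp only [mem_filter, mem_univ, true_and] at hy ⊢
    rw [← hy.2]
    exact hy.1.2
  · rintro ⟨y₁, y₂⟩ hy ⟨y₁', y₂'⟩ hy' h
    simp only [mem_filter, mem_univ, true_and] at hy hy' h
    rw [hy.2, hy'.2, h]
  · intro y hy
    simp only [mem_filter, mem_univ, true_and] at hx hy
    exact ⟨(x, y), by simpa using ⟨hx, hy⟩, rfl⟩

theorem card_list_heavy_mul_le {W : Type*} [Fintype W] {ℓ n : ℕ} (v : W → Fin ℓ → ZMod 2)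
    (A : Finset W) (j t : ℕ)
    (hv : ∀ f : Fin j → W, f.Injective → (∀ i, f i ∈ A) →
      LinearIndependent (ZMod 2) fun i => v (f i))
    (u : Fin n → ZMod 2) :
    (#{G : Matrix (Fin ℓ) (Fin n) (ZMod 2) |
        j ≤ #{w ∈ A | hammingDist (Matrix.vecMul (v w) G) u ≤ t}} : ℝ) * 2 ^ (n * j) ≤
      (Fintype.card W * hammingBallCard n t : ℝ) ^ j *
        Fintype.card (Matrix (Fin ℓ) (Fin n) (ZMod 2)) := by
  have key := card_mul_mul_le_of_double_count
    {G : Matrix (Fin ℓ) (Fin n) (ZMod 2) |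
      j ≤ #{w ∈ A | hammingDist (Matrix.vecMul (v w) G) u ≤ t}}
    {f : Fin j → W | f.Injective ∧ ∀ i, f i ∈ A}
    (fun G f => ∀ i, hammingDist (Matrix.vecMul (v (f i)) G) u ≤ t)
    (κ := 1) (N := 2 ^ (n * j))
    (C := (hammingBallCard n t : ℝ) ^ j * Fintype.card (Matrix (Fin ℓ) (Fin n) (ZMod 2)))
    (by positivity) ?_ ?_
  · rw [mul_one] at key
    refine key.trans ?_
    rw [mul_pow, mul_assoc]
    gcongr
    exact_mod_cast (card_filter_le _ _).trans (by simp)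
  · intro G hG
    obtain ⟨g⟩ : Nonempty (Fin j ↪ {w ∈ A | hammingDist (Matrix.vecMul (v w) G) u ≤ t}) := by
      rw [Function.Embedding.nonempty_iff_card_le, Fintype.card_fin, Fintype.card_coe]
      exact (mem_filter.1 hG).2
    have hg : ∀ i, (g i : W) ∈ A ∧ hammingDist (Matrix.vecMul (v (g i)) G) u ≤ t :=
      fun i => mem_filter.1 (g i).2
    rw [Nat.one_le_cast, Nat.one_le_iff_ne_zero, card_ne_zero]
    refine ⟨fun i => g i, ?_⟩
    simp only [mem_filter, mem_univ, true_and]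
    exact ⟨⟨fun i i' h => g.injective (Subtype.ext h), fun i => (hg i).1⟩, fun i => (hg i).2⟩
  · intro f hf
    simp only [mem_filter, mem_univ, true_and] at hf
    have hcard := card_filter_vecMul_mul (n := n) (fun i => v (f i)) (hv f hf.1 hf.2)
      (fun y => ∀ i, hammingDist (y i) u ≤ t) (N := hammingBallCard n t ^ j) (by
        rw [← card_filter_hammingDist_le t u]
        convert card_filter_forall (fun x : Fin n → ZMod 2 => hammingDist x u ≤ t))
    rw [Fintype.card_fin] at hcard
    exact_mod_cast hcard.le

/-- `q` is an alternative to the codeword indexed by `(m, w)` when `x (m, w)` reads `z` on `S` and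
is shifted by `e`. -/
def Confusable {a b n : ℕ} (x : (Fin a → ZMod 2) × (Fin b → ZMod 2) → Fin n → ZMod 2)
    (m : Fin a → ZMod 2) (S : Finset (Fin n)) (z e : Fin n → ZMod 2) (t : ℕ)
    (w : Fin b → ZMod 2) (q : (Fin a → ZMod 2) × (Fin b → ZMod 2)) : Prop :=
  (∀ c ∈ S, x (m, w) c = z c) ∧ hammingDist (x q) (x (m, w) + e) ≤ t

/-- Families of `j` disjoint pairs, each made of a nonzero index `(m, w)` and a nonzero index whose
message differs from `m`. -/
noncomputable def indexMatchings {a : ℕ} (b : ℕ) (m : Fin a → ZMod 2) (j : ℕ) :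
    Finset (Fin j → (Fin b → ZMod 2) × ((Fin a → ZMod 2) × (Fin b → ZMod 2))) :=
  {f | (fun i => (f i).1).Injective ∧ (fun i => (f i).2).Injective ∧
    ∀ i, (m, (f i).1) ≠ 0 ∧ (f i).2 ≠ 0 ∧ (f i).2.1 ≠ m}

theorem hammingDist_add_right_eq_sub {n : ℕ} (x y e : Fin n → ZMod 2) :
    hammingDist x (y + e) = hammingDist y (x - e) := by
  simp only [hammingDist, Pi.add_apply, Pi.sub_apply, ne_eq]
  congr 1
  ext i
  simp only [mem_filter, mem_univ, true_and, not_iff_not]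
  rw [eq_sub_iff_add_eq, eq_comm]

theorem exists_many_indexMatchings {a b n : ℕ}
    (x : (Fin a → ZMod 2) × (Fin b → ZMod 2) → Fin n → ZMod 2) (m : Fin a → ZMod 2)
    (S : Finset (Fin n)) (z e : Fin n → ZMod 2) (t j : ℕ)
    (hlist : ∀ u, #{w ∈ ({w | (m, w) ≠ 0} : Finset (Fin b → ZMod 2)) |
      hammingDist (x (m, w)) u ≤ t} < j) :
    ∃ D : ℕ, #{w | ∃ q : (Fin a → ZMod 2) × (Fin b → ZMod 2),
        q.1 ≠ m ∧ Confusable x m S z e t w q} ≤ 1 + j + j * D ∧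
      (D + 1 - j) ^ j ≤
        #{f ∈ indexMatchings b m j | ∀ i, Confusable x m S z e t (f i).1 (f i).2} := by
  let r : (Fin b → ZMod 2) → (Fin a → ZMod 2) × (Fin b → ZMod 2) → Prop :=
    fun w q => q ≠ 0 ∧ q.1 ≠ m ∧ Confusable x m S z e t w q
  let B : Finset (Fin b → ZMod 2) := {w | (m, w) ≠ 0 ∧ ∃ q, r w q}
  have hfib : ∀ q, #{w | (m, w) ≠ 0 ∧ hammingDist (x q) (x (m, w) + e) ≤ t} ≤ j := by
    intro q
    refine le_trans (card_le_card fun w hw => ?_) (hlist (x q - e)).le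
    simpa [hammingDist_add_right_eq_sub (x q)] using hw
  obtain ⟨D, hD, hmany⟩ := exists_many_matchings B r j (fun w hw => (mem_filter.1 hw).2.2)
    fun q => (card_le_card fun w hw => by
      simp only [B, mem_filter, mem_univ, true_and] at hw ⊢
      exact ⟨hw.1.1, hw.2.2.2.2⟩).trans (hfib q)
  refine ⟨D, ?_, hmany.trans (card_le_card fun f hf => ?_)⟩
  · have hsub : ({w | ∃ q : (Fin a → ZMod 2) × (Fin b → ZMod 2),
        q.1 ≠ m ∧ Confusable x m S z e t w q} : Finset _) ⊆
        {0} ∪ ({w | (m, w) ≠ 0 ∧ hammingDist (x 0) (x (m, w) + e) ≤ t} : Finset _) ∪ B := by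
      intro w hw
      simp only [mem_filter, mem_univ, true_and] at hw
      obtain ⟨q, hqm, hq⟩ := hw
      by_cases hw0 : (m, w) = 0
      · have hw' : w = 0 := (Prod.ext_iff.1 hw0).2
        simp [hw']
      by_cases hq0 : q = 0
      · subst hq0
        refine mem_union_left _ (mem_union_right _ ?_)
        exact mem_filter.2 ⟨mem_univ _, hw0, hq.2⟩
      · exact mem_union_right _ (mem_filter.2 ⟨mem_univ _, hw0, q, hq0, hqm, hq⟩)
    refine (card_le_card hsub).trans ((card_union_le _ _).trans ?_)
    gcongr
    refine (card_union_le _ _).trans ?_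
    gcongr
    · simp
    · exact hfib 0
  · simp only [indexMatchings, mem_filter, mem_univ, true_and, B, r] at hf ⊢
    exact ⟨⟨hf.1, hf.2.1, fun i => ⟨(hf.2.2 i).1.1, (hf.2.2 i).2.1, (hf.2.2 i).2.2.1⟩⟩,
      fun i => (hf.2.2 i).2.2.2⟩

theorem linearIndependent_of_injective {K Q V ι : Type*} [Field K] [AddCommGroup V] [Module K V]
    [Zero Q] [Fintype ι] {k : ℕ} (h : Q → V)
    (hk : ∀ T : Finset Q, 0 ∉ T → #T ≤ k → LinearIndependent K fun q : T => h q.val)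
    (v : ι → Q) (hv : v.Injective) (hv0 : ∀ i, v i ≠ 0) (hι : Fintype.card ι ≤ k) :
    LinearIndependent K fun i => h (v i) := by
  have hT := hk (univ.image v) (by simpa using hv0)
    (by rwa [card_image_of_injective _ hv, card_univ])
  exact hT.comp (fun i => ⟨v i, mem_image_of_mem v (mem_univ i)⟩)
    fun i i' hi => hv (congrArg Subtype.val hi)

theorem card_many_indexMatchings_mul_le {a b ℓ n k j : ℕ}
    (h : (Fin a → ZMod 2) × (Fin b → ZMod 2) → Fin ℓ → ZMod 2)
    (hk : ∀ T : Finset ((Fin a → ZMod 2) × (Fin b → ZMod 2)), 0 ∉ T → #T ≤ k →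
      LinearIndependent (ZMod 2) fun q : T => h q.val)
    (hjk : j + j ≤ k) (m : Fin a → ZMod 2) (S : Finset (Fin n)) (z e : Fin n → ZMod 2) (t : ℕ)
    (B : Finset (Matrix (Fin ℓ) (Fin n) (ZMod 2))) {κ : ℝ}
    (hB : ∀ G ∈ B, κ ≤ #{f ∈ indexMatchings b m j |
      ∀ i, Confusable (fun q => Matrix.vecMul (h q) G) m S z e t (f i).1 (f i).2}) :
    #B * κ * (2 ^ (n * (j + j)) * 2 ^ (#S * j)) ≤
      (2 ^ b * 2 ^ (a + b) * (2 ^ n * hammingBallCard n t) : ℝ) ^ j *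
        Fintype.card (Matrix (Fin ℓ) (Fin n) (ZMod 2)) := by
  have key := card_mul_mul_le_of_double_count B (indexMatchings b m j)
    (fun G f => ∀ i, Confusable (fun q => Matrix.vecMul (h q) G) m S z e t (f i).1 (f i).2)
    (κ := κ) (N := 2 ^ (n * (j + j)) * 2 ^ (#S * j))
    (C := (2 ^ n * hammingBallCard n t : ℝ) ^ j *
      Fintype.card (Matrix (Fin ℓ) (Fin n) (ZMod 2))) (by positivity)
    (fun G hG => by convert hB G hG) ?_
  · refine key.trans ?_
    rw [mul_pow (2 ^ b * 2 ^ (a + b) : ℝ), mul_assoc]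
    gcongr
    exact_mod_cast (card_filter_le _ _).trans (by simp [ZMod.card, pow_add])
  · intro f hf
    simp only [indexMatchings, mem_filter, mem_univ, true_and] at hf
    have hli := linearIndependent_of_injective h hk
      (Sum.elim (fun i => (m, (f i).1)) fun i => (f i).2)
      (Function.Injective.sumElim (fun i i' hi => hf.1 (Prod.ext_iff.1 hi).2) hf.2.1
        fun i i' hi => (hf.2.2 i').2.2 (by rw [← hi]))
      (by rintro (i | i); exacts [(hf.2.2 i).1, (hf.2.2 i).2.1]) (by simpa using hjk)
    obtain ⟨N, hN⟩ : ∃ N, N = #{x : (Fin n → ZMod 2) × (Fin n → ZMod 2) |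
      (∀ c ∈ S, x.1 c = z c) ∧ hammingDist x.2 (x.1 + e) ≤ t} := ⟨_, rfl⟩
    have hcard : #{G : Matrix (Fin ℓ) (Fin n) (ZMod 2) |
          ∀ i, Confusable (fun q => Matrix.vecMul (h q) G) m S z e t (f i).1 (f i).2} *
        2 ^ (n * Fintype.card (Fin j ⊕ Fin j)) =
        N ^ j * Fintype.card (Matrix (Fin ℓ) (Fin n) (ZMod 2)) := by
      convert card_filter_vecMul_mul (n := n) _ hli
        (fun y => ∀ i, (∀ c ∈ S, y (.inl i) c = z c) ∧
          hammingDist (y (.inr i)) (y (.inl i) + e) ≤ t) (N := N ^ j)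
        (by rw [hN]; convert card_filter_forall_sum (j := j) (fun x₁ x₂ : Fin n → ZMod 2 =>
              (∀ c ∈ S, x₁ c = z c) ∧ hammingDist x₂ (x₁ + e) ≤ t))
      exact Iff.rfl
    rw [Fintype.card_sum, Fintype.card_fin] at hcard
    have hpow := card_filter_agree_and_close_mul t S z e
    rw [← hN] at hpow
    have hpow' : (2 : ℝ) ^ n * hammingBallCard n t = N * 2 ^ #S := by exact_mod_cast hpow.symm
    rw [hpow', mul_pow, ← pow_mul, mul_right_comm, ← mul_assoc]
    have hcast := congrArg (Nat.cast : ℕ → ℝ) hcard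
    push_cast at hcast
    refine mul_le_mul_of_nonneg_right (le_of_eq ?_) (by positivity)
    convert hcast
    rfl

theorem exists_fiber_card_gt {W Z : Type*} [Fintype W] [Fintype Z] [Nonempty Z] (o : W → Z)
    (P : W → Prop) [DecidablePred P] {c : ℝ} (hc : c < #{w | P w}) :
    ∃ z, c / Fintype.card Z < #{w | o w = z ∧ P w} := by
  by_contra! hle
  have hZ : (0 : ℝ) < Fintype.card Z := by exact_mod_cast Fintype.card_pos
  have hsum : #{w | P w} = ∑ z, #{w | o w = z ∧ P w} := by
    rw [card_eq_sum_card_fiberwise (f := o) (t := univ) (by simp)]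
    refine sum_congr rfl fun z _ => ?_
    rw [filter_filter]
    simp only [and_comm]
  refine hc.not_ge ?_
  rw [hsum, Nat.cast_sum]
  refine (sum_le_card_nsmul univ _ _ fun z _ => hle z).trans ?_
  rw [card_univ, nsmul_eq_mul, mul_div_cancel₀ _ hZ.ne']

theorem exists_confusable_card_gt {a b n s t : ℕ}
    (x : (Fin a → ZMod 2) × (Fin b → ZMod 2) → Fin n → ZMod 2) (m : Fin a → ZMod 2) (δ : ℝ)
    (S : Finset (Fin n)) (hS : #S = s)
    (e : ({i : Fin n // i ∈ S} → ZMod 2) → Fin n → ZMod 2) (he : ∀ y, hammingDist (e y) 0 ≤ t)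
    (hδ : δ < (#{w : Fin b → ZMod 2 | ∃ (m' : Fin a → ZMod 2) (w' : Fin b → ZMod 2), m' ≠ m ∧
      hammingDist (x (m', w')) (x (m, w) + e fun i => x (m, w) i.val) ≤
        hammingDist (x (m, w)) (x (m, w) + e fun i => x (m, w) i.val)} : ℝ) / 2 ^ b) :
    ∃ z e' : Fin n → ZMod 2, δ * 2 ^ b / 2 ^ s <
      #{w | ∃ q : (Fin a → ZMod 2) × (Fin b → ZMod 2),
        q.1 ≠ m ∧ Confusable x m S z e' t w q} := by
  rw [lt_div_iff₀ (by positivity)] at hδ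
  obtain ⟨y, hy⟩ := exists_fiber_card_gt (fun w (i : {i : Fin n // i ∈ S}) => x (m, w) i.val) _ hδ
  have hcard : Fintype.card ({i : Fin n // i ∈ S} → ZMod 2) = 2 ^ s := by simp [ZMod.card, hS]
  rw [hcard, Nat.cast_pow, Nat.cast_ofNat] at hy
  refine ⟨fun c => if hc : c ∈ S then y ⟨c, hc⟩ else 0, e y, hy.trans_le ?_⟩
  gcongr with w
  rintro ⟨rfl, m', w', hm', hd⟩
  refine ⟨(m', w'), hm', fun c hc => by simp [hc],
    hd.trans (le_trans (le_of_eq ?_) (he fun i => x (m, w) i.val))⟩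
  simp [hammingDist]

theorem card_bad_le {a b s t ℓ n k j : ℕ}
    (h : (Fin a → ZMod 2) × (Fin b → ZMod 2) → Fin ℓ → ZMod 2)
    (hk : ∀ T : Finset ((Fin a → ZMod 2) × (Fin b → ZMod 2)), 0 ∉ T → #T ≤ k →
      LinearIndependent (ZMod 2) fun q : T => h q.val)
    (hj : 0 < j) (hjk : j + j ≤ k) (m : Fin a → ZMod 2) {δ : ℝ} (hδ : 0 < δ)
    (hlarge : 2 * (1 + (j : ℝ) ^ 2) ≤ δ * 2 ^ b / 2 ^ s)
    (B : Finset (Matrix (Fin ℓ) (Fin n) (ZMod 2)))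
    (hB : ∀ G ∈ B, ∃ (S : Finset (Fin n)) (z e : Fin n → ZMod 2), #S = s ∧
      δ * 2 ^ b / 2 ^ s < #{w | ∃ q : (Fin a → ZMod 2) × (Fin b → ZMod 2),
        q.1 ≠ m ∧ Confusable (fun q => Matrix.vecMul (h q) G) m S z e t w q}) :
    (#B : ℝ) / Fintype.card (Matrix (Fin ℓ) (Fin n) (ZMod 2)) ≤
      2 ^ n * (2 ^ b * hammingBallCard n t / 2 ^ n) ^ j +
        (2 ^ n) ^ 3 * (2 * j / δ * (2 ^ (a + b) * hammingBallCard n t / 2 ^ n)) ^ j := by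
  set M : ℝ := Nat.cast (Fintype.card (Matrix (Fin ℓ) (Fin n) (ZMod 2))) with hM
  have hMpos : 0 < M := by rw [hM]; exact_mod_cast Fintype.card_pos
  have hj' : (0 : ℝ) < j := by exact_mod_cast hj
  set K : ℝ := δ * 2 ^ b / 2 ^ s / (2 * j) with hK
  have hKpos : 0 < K := by positivity
  let x (G : Matrix (Fin ℓ) (Fin n) (ZMod 2)) : (Fin a → ZMod 2) × (Fin b → ZMod 2) →
    Fin n → ZMod 2 := fun q => Matrix.vecMul (h q) G
  let L (u : Fin n → ZMod 2) : Finset (Matrix (Fin ℓ) (Fin n) (ZMod 2)) :=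
    {G | j ≤ #{w ∈ ({w | (m, w) ≠ 0} : Finset (Fin b → ZMod 2)) |
      hammingDist (Matrix.vecMul (h (m, w)) G) u ≤ t}}
  let T : Finset (Finset (Fin n) × (Fin n → ZMod 2) × (Fin n → ZMod 2)) := {c | #c.1 = s}
  let C (c : Finset (Fin n) × (Fin n → ZMod 2) × (Fin n → ZMod 2)) :
      Finset (Matrix (Fin ℓ) (Fin n) (ZMod 2)) :=
    {G | K ^ j ≤ #{f ∈ indexMatchings b m j |
      ∀ i, Confusable (x G) m c.1 c.2.1 c.2.2 t (f i).1 (f i).2}}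
  have hcover : B ⊆ univ.biUnion L ∪ T.biUnion C := by
    intro G hG
    by_cases hL : ∃ u, G ∈ L u
    · obtain ⟨u, hu⟩ := hL
      exact mem_union_left _ (mem_biUnion.2 ⟨u, mem_univ _, hu⟩)
    · refine mem_union_right _ ?_
      obtain ⟨S, z, e, hS, hlt⟩ := hB G hG
      refine mem_biUnion.2 ⟨(S, z, e), mem_filter.2 ⟨mem_univ _, hS⟩, ?_⟩
      obtain ⟨D, hD, hmany⟩ := exists_many_indexMatchings (x G) m S z e t j fun u => by
        by_contra! hu
        exact hL ⟨u, mem_filter.2 ⟨mem_univ _, hu⟩⟩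
      refine mem_filter.2 ⟨mem_univ _, le_trans ?_ (Nat.cast_le.2 hmany)⟩
      rw [Nat.cast_pow]
      gcongr
      have h1 : (D : ℝ) + 1 ≤ (D + 1 - j : ℕ) + j := by
        exact_mod_cast (le_tsub_add : D + 1 ≤ D + 1 - j + j)
      have h2 : δ * 2 ^ b / 2 ^ s < 1 + j + j * D := hlt.trans_le (by exact_mod_cast hD)
      rw [hK, div_le_iff₀ (by positivity)]
      nlinarith
  have hL : ∀ u, (#(L u) : ℝ) ≤ (2 ^ b * hammingBallCard n t / 2 ^ n) ^ j * M := by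
    intro u
    have := card_list_heavy_mul_le (fun w => h (m, w)) {w | (m, w) ≠ 0} j t
      (fun f hf hf0 => linearIndependent_of_injective h hk (fun i => (m, f i))
        (fun i i' hi => hf (Prod.ext_iff.1 hi).2) (fun i => by simpa using hf0 i)
        (by rw [Fintype.card_fin]; omega)) u
    rw [div_pow, ← pow_mul, div_mul_eq_mul_div, le_div_iff₀ (by positivity)]
    have hW : (Fintype.card (Fin b → ZMod 2) : ℝ) = 2 ^ b := by simp [ZMod.card]
    rwa [hW] at this
  have hC : ∀ c ∈ T, (#(C c) : ℝ) ≤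
      (2 * j / δ * (2 ^ (a + b) * hammingBallCard n t / 2 ^ n)) ^ j * M := by
    intro c hc
    have := card_many_indexMatchings_mul_le h hk hjk m c.1 c.2.1 c.2.2 t (C c)
      (fun G hG => (mem_filter.1 hG).2)
    rw [(mem_filter.1 hc).2, mul_assoc, ← le_div_iff₀ (by positivity)] at this
    refine this.trans (le_of_eq ?_)
    rw [mul_div_right_comm]
    congr 1
    have hn : (2 : ℝ) ^ (n * (j + j)) = ((2 ^ n) ^ 2) ^ j := by ring
    rw [hn, pow_mul (2 : ℝ) s j, ← mul_pow, ← mul_pow, ← div_pow, hK]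
    congr 1
    field_simp
  have hT : (#T : ℝ) ≤ (2 ^ n) ^ 3 := by
    have := card_filter_le (univ : Finset (Finset (Fin n) × (Fin n → ZMod 2) × (Fin n → ZMod 2)))
      fun c => #c.1 = s
    rw [card_univ, Fintype.card_prod, Fintype.card_prod] at this
    simp only [Fintype.card_finset, Fintype.card_fun, ZMod.card, Fintype.card_fin] at this
    calc (#T : ℝ) ≤ (2 ^ n * (2 ^ n * 2 ^ n) : ℕ) := by exact_mod_cast this
      _ = (2 ^ n) ^ 3 := by push_cast; ring
  rw [div_le_iff₀ hMpos, add_mul]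
  calc (#B : ℝ) ≤ (#(univ.biUnion L) : ℝ) + #(T.biUnion C) := by
        exact_mod_cast (card_le_card hcover).trans (card_union_le _ _)
    _ ≤ (∑ u, #(L u) : ℕ) + (∑ c ∈ T, #(C c) : ℕ) := by
        gcongr <;> exact card_biUnion_le
    _ ≤ 2 ^ n * ((2 ^ b * hammingBallCard n t / 2 ^ n) ^ j * M) +
        #T * ((2 * j / δ * (2 ^ (a + b) * hammingBallCard n t / 2 ^ n)) ^ j * M) := by
        push_cast
        gcongr
        · refine (sum_le_card_nsmul _ _ _ fun u _ => hL u).trans (le_of_eq ?_)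
          simp [ZMod.card]
        · exact (sum_le_card_nsmul _ _ _ hC).trans (le_of_eq (nsmul_eq_mul _ _))
    _ ≤ _ := by
        rw [← mul_assoc, ← mul_assoc]
        gcongr

/-- Reliability of random pseudolinear codes over the `(p,r)`-AWTC II
(Theorem 1 of Ruzomberka et al. 2023): if `R' > r` and `R + R' < 1 − H₂(p)`, then for
every large enough fixed `k` and any `δ > 0` there is `γ₂ > 0` such that for all large
`n` and every message `m`, the probability over a uniformly random generator matrix `G`
that the pseudolinear code `x(m,w) = h(m,w)·G` has (worst-case over read sets `S` of
size `rn` and error maps `e` of weight `≤ pn`) error probability exceeding `δ` under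
minimum-distance decoding is at most `2^{−kγ₂n}`. -/
theorem random_pseudolinear_codes_reliable
    (p r R R' : ℝ) (hp0 : 0 < p) (hp1 : p < 1 / 2) (hr0 : 0 ≤ r) (hr1 : r ≤ 1)
    (hrH : r < 1 - H2 p) (hR' : r < R') (hsum : R + R' < 1 - H2 p) :
    ∃ k₀ : ℕ, ∀ k : ℕ, k₀ ≤ k → ∀ δ : ℝ, 0 < δ →
      ∃ γ₂ : ℝ, 0 < γ₂ ∧
        ∃ n₀ : ℕ, ∀ n : ℕ, n₀ ≤ n →
          ∀ a b s t : ℕ, (a : ℝ) = R * n → (b : ℝ) = R' * n →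
            (s : ℝ) = r * n → (t : ℝ) = p * n →
          ∀ (ℓ : ℕ) (h : (Fin a → ZMod 2) × (Fin b → ZMod 2) → Fin ℓ → ZMod 2),
            (∀ q, q ≠ 0 → h q ≠ 0) →
            (∀ q q', q ≠ 0 → q' ≠ 0 → q ≠ q' → h q ≠ h q') →
            (∀ T : Finset ((Fin a → ZMod 2) × (Fin b → ZMod 2)),
              0 ∉ T → T.card ≤ k →
              LinearIndependent (ZMod 2) (fun q : T => h q.val)) →
          ∀ m : Fin a → ZMod 2,
            ((Finset.univ.filter (fun G : Matrix (Fin ℓ) (Fin n) (ZMod 2) =>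
              -- the event  P_error^{(m)}(𝒞ₙ) > δ :
              ∃ (S : Finset (Fin n))
                (e : ({i : Fin n // i ∈ S} → ZMod 2) → Fin n → ZMod 2),
                S.card = s ∧ (∀ z, hammingDist (e z) 0 ≤ t) ∧
                δ < ((Finset.univ.filter (fun w : Fin b → ZMod 2 =>
                    ∃ (m' : Fin a → ZMod 2) (w' : Fin b → ZMod 2), m' ≠ m ∧
                      hammingDist (Matrix.vecMul (h (m', w')) G)
                          (Matrix.vecMul (h (m, w)) G +
                            e (fun i : {i : Fin n // i ∈ S} =>
                                Matrix.vecMul (h (m, w)) G i.val))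
                        ≤ hammingDist (Matrix.vecMul (h (m, w)) G)
                          (Matrix.vecMul (h (m, w)) G +
                            e (fun i : {i : Fin n // i ∈ S} =>
                                Matrix.vecMul (h (m, w)) G i.val)))).card : ℝ)
                    / (2 : ℝ) ^ b)).card : ℝ)
              / (Fintype.card (Matrix (Fin ℓ) (Fin n) (ZMod 2)) : ℝ)
            ≤ (2 : ℝ) ^ (-((k : ℝ) * γ₂ * n)) := by
  set ε : ℝ := 1 - H2 p - (R + R') with hε
  have hεpos : 0 < ε := by linarith
  obtain ⟨c, hc⟩ := exists_nat_gt (10 / ε)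
  have hcpos : (0 : ℝ) < c := (by positivity : (0 : ℝ) < 10 / ε).trans hc
  rw [div_lt_iff₀ hεpos] at hc
  refine ⟨2 * c, fun k hk δ hδ => ?_⟩
  have hcN : 0 < c := by exact_mod_cast hcpos
  have hkpos : (0 : ℝ) < k := by exact_mod_cast (by omega : 0 < k)
  have hgrow : ∀ {α : ℝ}, 0 < α → ∀ A : ℝ, ∀ᶠ n : ℕ in Filter.atTop, A ≤ (2 : ℝ) ^ (α * n) := by
    intro α hα A
    have h2 : Filter.Tendsto (fun n : ℕ => ((2 : ℝ) ^ α) ^ n) Filter.atTop Filter.atTop :=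
      tendsto_pow_atTop_atTop_of_one_lt (Real.one_lt_rpow (by norm_num) hα)
    filter_upwards [h2.eventually_ge_atTop A] with n hn
    rwa [Real.rpow_mul (by norm_num), Real.rpow_natCast]
  obtain ⟨n₀, hn₀⟩ := Filter.eventually_atTop.1
    (((hgrow (sub_pos.2 hR') (2 * (1 + (c : ℝ) ^ 2) / δ)).and
      (hgrow (half_pos hεpos) (2 * c / δ))).and (Filter.eventually_ge_atTop 1))
  refine ⟨1 / k, by positivity, n₀, fun n hn a b s t ha hb hs ht ℓ h _ _ hli m => ?_⟩
  obtain ⟨⟨hn1, hn2⟩, hn3⟩ := hn₀ n hn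
  have hnpos : (1 : ℝ) ≤ n := by exact_mod_cast hn3
  have hpow : ∀ d : ℕ, (2 : ℝ) ^ d = 2 ^ (d : ℝ) := fun d => (Real.rpow_natCast 2 d).symm
  have hlarge : 2 * (1 + (c : ℝ) ^ 2) ≤ δ * 2 ^ b / 2 ^ s := by
    rw [mul_div_assoc, hpow b, hpow s, ← Real.rpow_sub (by norm_num), hb, hs, ← sub_mul]
    rwa [div_le_iff₀' hδ] at hn1
  have hV := hammingBallCard_le hp0 hp1 ht
  have hrate : 2 ^ (a + b) * (hammingBallCard n t : ℝ) / 2 ^ n ≤ 2 ^ (-(ε * n)) := by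
    calc 2 ^ (a + b) * (hammingBallCard n t : ℝ) / 2 ^ n
        ≤ 2 ^ (a + b) * 2 ^ (H2 p * n) / 2 ^ n := by gcongr
      _ = 2 ^ (-(ε * n)) := by
        rw [hpow (a + b), hpow n, ← Real.rpow_add (by norm_num), ← Real.rpow_sub (by norm_num)]
        congr 1
        push_cast
        rw [ha, hb, hε]
        ring
  have hhalf : (2 : ℝ) ^ (-(ε * n)) = 2 ^ (-(ε / 2 * n)) * 2 ^ (-(ε / 2 * n)) := by
    rw [← Real.rpow_add (by norm_num)]
    congr 1
    ring
  have hle1 : (2 : ℝ) ^ (-(ε / 2 * n)) ≤ 1 :=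
    Real.rpow_le_one_of_one_le_of_nonpos (by norm_num)
      (by simp only [Left.neg_nonpos_iff]; positivity)
  have hfirst : 2 ^ b * (hammingBallCard n t : ℝ) / 2 ^ n ≤ 2 ^ (-(ε / 2 * n)) := by
    calc 2 ^ b * (hammingBallCard n t : ℝ) / 2 ^ n
        ≤ 2 ^ (a + b) * (hammingBallCard n t : ℝ) / 2 ^ n := by
          gcongr
          · norm_num
          · omega
      _ ≤ 2 ^ (-(ε * n)) := hrate
      _ ≤ 2 ^ (-(ε / 2 * n)) := by
          rw [hhalf]
          exact mul_le_of_le_one_left (by positivity) hle1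
  have hsecond : 2 * c / δ * (2 ^ (a + b) * (hammingBallCard n t : ℝ) / 2 ^ n) ≤
      2 ^ (-(ε / 2 * n)) := by
    calc 2 * c / δ * (2 ^ (a + b) * (hammingBallCard n t : ℝ) / 2 ^ n)
        ≤ 2 ^ (ε / 2 * n) * 2 ^ (-(ε * n)) := by gcongr
      _ = 2 ^ (-(ε / 2 * n)) := by
        rw [← Real.rpow_add (by norm_num)]
        congr 1
        ring
  refine (card_bad_le (j := c) h hli hcN (by omega) m hδ hlarge (t := t) _ ?_).trans ?_
  · intro G hG
    obtain ⟨S, e, hS, he, hlt⟩ := (mem_filter.1 hG).2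
    obtain ⟨z, e', hz⟩ := exists_confusable_card_gt (fun q => Matrix.vecMul (h q) G) m δ S hS e he
      (by convert hlt)
    exact ⟨S, z, e', hS, hz⟩
  · have htwo : (2 : ℝ) ≤ 2 ^ n := by
      simpa using pow_le_pow_right₀ (one_le_two : (1 : ℝ) ≤ 2) hn3
    calc _ ≤ (2 : ℝ) ^ n * (2 ^ (-(ε / 2 * n))) ^ c + (2 ^ n) ^ 3 * (2 ^ (-(ε / 2 * n))) ^ c := by
          gcongr
      _ ≤ (2 ^ n) ^ 3 * (2 ^ (-(ε / 2 * n))) ^ c + (2 ^ n) ^ 3 * (2 ^ (-(ε / 2 * n))) ^ c := by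
          gcongr
          exact le_self_pow₀ (by linarith) (by norm_num)
      _ = 2 * ((2 ^ n) ^ 3 * (2 ^ (-(ε / 2 * n))) ^ c) := by ring
      _ ≤ 2 ^ n * ((2 ^ n) ^ 3 * (2 ^ (-(ε / 2 * n))) ^ c) := by gcongr
      _ = 2 ^ ((4 - c * ε / 2) * n) := by
          rw [← mul_assoc, ← pow_succ', ← pow_mul, hpow, ← Real.rpow_natCast (2 ^ (-(ε / 2 * n))),
            ← Real.rpow_mul (by norm_num), ← Real.rpow_add (by norm_num)]
          congr 1
          push_cast
          ring
      _ ≤ _ := by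
          rw [mul_one_div_cancel hkpos.ne']
          refine Real.rpow_le_rpow_of_exponent_le (by norm_num) ?_
          nlinarith
end

section
/- Let n be a positive integer, R, r ∈ (0,1) with Rn and rn integers, and let H ∈ GF(2)^{Rn × n} be a full-rank parity check matrix. Consider the linear coset coding scheme: M is uniform on {0,1}^{Rn} and, given M = m, X is uniform on {x ∈ {0,1}^n : x·Hᵀ = m}. For S ⊆ {1,…,n} with |S| = rn, let Z be the restriction of X to the coordinates in S, and let H(M|Z) denote the base-2 conditional entropy. Then min over S ⊆ {1,…,n} with |S| = rn of H(M|Z) equals min over I ⊆ {1,…,n} with |I| = (1−r)n of rank(H(I)), where H(I) denotes the submatrix of H formed by the columns indexed by I and rank is over GF(2). -/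
open Finset
open scoped Classical

/-- Base-2 conditional entropy `H(M|Z)` of a finite joint distribution `P` on `M × Z`
(the marginal of `Z` is computed from the joint). -/
noncomputable def condEnt {M Z : Type*} [Fintype M] [Fintype Z]
    (P : M → Z → ℝ) : ℝ :=
  -∑ m, ∑ z, P m z * Real.logb 2 (P m z / (∑ m', P m' z))

/-- If a joint distribution is uniform on its support, with value `p`, and its second marginal
is uniform with value `q`, then the conditional entropy is `-log₂ (p / q)`. -/
theorem condEnt_eq_neg_logb {M Z : Type*} [Fintype M] [Fintype Z] (P : M → Z → ℝ) (p q : ℝ)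
    (hP : ∀ m z, P m z = 0 ∨ P m z = p) (hq : ∀ z, ∑ m, P m z = q)
    (hsum : ∑ m, ∑ z, P m z = 1) : condEnt P = -Real.logb 2 (p / q) := by
  have h : ∀ m z, P m z * Real.logb 2 (P m z / ∑ m', P m' z) = P m z * Real.logb 2 (p / q) := by
    intro m z
    rw [hq]
    rcases hP m z with h | h <;> simp [h]
  simp only [condEnt, h, ← Finset.sum_mul, hsum, one_mul]

theorem card_fiber_mul_card_of_surjective {V W : Type*} [AddGroup V] [Fintype V] [AddGroup W]
    [Fintype W] [DecidableEq W] (f : V →+ W) (hf : Function.Surjective f) (w : W) :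
    (univ.filter fun x => f x = w).card * Fintype.card W = Fintype.card V := by
  have h := Finset.card_eq_sum_card_fiberwise (f := f) (s := univ) (t := univ) (by simp)
  rw [Finset.sum_congr rfl fun y _ => AddMonoidHom.card_fiber_eq_of_mem_range f (hf y) (hf w)] at h
  simp only [Finset.sum_const, Finset.card_univ, smul_eq_mul] at h
  rw [h, mul_comm]

theorem card_mulVec_eq_zero_mul_two_pow_rank {m k : Type*} [Fintype m] [Fintype k]
    (B : Matrix m k (ZMod 2)) :
    (univ.filter fun y : k → ZMod 2 => B.mulVec y = 0).card * 2 ^ B.rank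
      = 2 ^ Fintype.card k := by
  have h1 : (univ.filter fun y : k → ZMod 2 => B.mulVec y = 0).card
      = Nat.card (LinearMap.ker B.mulVecLin) := by
    rw [← Fintype.card_subtype, ← Nat.card_eq_fintype_card]
    rfl
  rw [h1, Module.natCard_eq_pow_finrank (K := ZMod 2), Nat.card_zmod, ← pow_add, Matrix.rank,
    add_comm, LinearMap.finrank_range_add_finrank_ker, Module.finrank_fintype_fun_eq_card]

theorem card_mulVec_eq_zero_of_restrict_eq_zero {m k : Type*} [Fintype m] [Fintype k]
    [DecidableEq k] (B : Matrix m k (ZMod 2)) (S : Finset k) :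
    (univ.filter fun x : k → ZMod 2 =>
        B.mulVec x = 0 ∧ (fun i : {i : k // i ∈ S} => x i.val) = 0).card
      = (univ.filter fun y : {i : k // i ∈ Sᶜ} → ZMod 2 =>
          (B.submatrix id fun i : {i : k // i ∈ Sᶜ} => i.val).mulVec y = 0).card := by
  have key : ∀ x : k → ZMod 2, (∀ i ∈ S, x i = 0) →
      (B.submatrix id fun i : {i : k // i ∈ Sᶜ} => i.val).mulVec
        (fun i : {i : k // i ∈ Sᶜ} => x i.val) = B.mulVec x := by
    intro x hx
    ext j
    simp only [Matrix.mulVec, dotProduct, Matrix.submatrix_apply, id]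
    rw [Finset.sum_coe_sort Sᶜ (fun i => B j i * x i)]
    apply Finset.sum_subset (Finset.subset_univ _)
    intro i _ hi
    rw [hx i (by simpa using hi), mul_zero]
  refine Finset.card_bij' (fun x _ i => x i.val)
    (fun y _ i => if h : i ∈ Sᶜ then y ⟨i, h⟩ else 0) ?_ ?_ ?_ ?_
  · intro x hx
    simp only [Finset.mem_filter, Finset.mem_univ, true_and] at hx ⊢
    rw [key x fun i hi => congrFun hx.2 ⟨i, hi⟩, hx.1]
  · intro y hy
    simp only [Finset.mem_filter, Finset.mem_univ, true_and] at hy ⊢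
    have h0 : ∀ i ∈ S, (if h : i ∈ Sᶜ then y ⟨i, h⟩ else 0) = 0 := by
      intro i hi
      simp [hi]
    refine ⟨?_, funext fun i => h0 i.val i.2⟩
    rw [← key _ h0, ← hy]
    congr 1
    ext i
    rw [dif_pos i.2]
  · intro x hx
    simp only [Finset.mem_filter, Finset.mem_univ, true_and] at hx
    ext i
    by_cases hi : i ∈ S
    · have := congrFun hx.2 ⟨i, hi⟩
      simp_all
    · simp [hi]
  · intro y _
    ext i
    exact dif_pos i.2

/-- The equivocation of the coset coding scheme when the coordinates in `S` are observed is the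
rank of the columns of `H` outside `S`. -/
theorem condEnt_coset_coding_eq_rank {a n : ℕ} (H : Matrix (Fin a) (Fin n) (ZMod 2))
    (hrank : H.rank = a) (S : Finset (Fin n)) :
    condEnt (fun (m : Fin a → ZMod 2) (z : {i : Fin n // i ∈ S} → ZMod 2) =>
        ((1 : ℝ) / (2 : ℝ) ^ a) *
          (((Finset.univ.filter (fun x : Fin n → ZMod 2 =>
              Matrix.vecMul x H.transpose = m ∧
                (fun i : {i : Fin n // i ∈ S} => x i.val) = z)).card : ℝ)
            / ((Finset.univ.filter (fun x : Fin n → ZMod 2 =>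
                Matrix.vecMul x H.transpose = m)).card : ℝ)))
      = ((H.submatrix id (fun i : {i : Fin n // i ∈ Sᶜ} => i.val)).rank : ℝ) := by
  simp only [Matrix.vecMul_transpose]
  let A : (Fin n → ZMod 2) →+ ({i : Fin n // i ∈ S} → ZMod 2) :=
    { toFun := fun x i => x i.val, map_zero' := rfl, map_add' := fun _ _ => rfl }
  have hL : Function.Surjective H.mulVecLin.toAddMonoidHom := by
    have h : LinearMap.range H.mulVecLin = ⊤ := by
      apply Submodule.eq_top_of_finrank_eq
      rw [Module.finrank_fintype_fun_eq_card, Fintype.card_fin]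
      exact hrank
    exact LinearMap.range_eq_top.1 h
  have hAs : Function.Surjective A := by
    intro z
    refine ⟨fun i => if h : i ∈ S then z ⟨i, h⟩ else 0, ?_⟩
    ext i
    exact dif_pos i.2
  have cL : ∀ m, ((univ.filter fun x => H.mulVec x = m).card : ℝ) * 2 ^ a = 2 ^ n := by
    intro m
    have h : (univ.filter fun x => H.mulVec x = m).card * _ = _ :=
      card_fiber_mul_card_of_surjective _ hL m
    simp only [Fintype.card_fun, ZMod.card, Fintype.card_fin] at h
    exact_mod_cast h
  have cA : ∀ z, ((univ.filter fun x => A x = z).card : ℝ) * 2 ^ S.card = 2 ^ n := by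
    intro z
    have h : (univ.filter fun x => A x = z).card * _ = _ :=
      card_fiber_mul_card_of_surjective A hAs z
    simp only [Fintype.card_fun, ZMod.card, Fintype.card_fin, Fintype.card_coe] at h
    exact_mod_cast h
  set ρ := (H.submatrix id (fun i : {i : Fin n // i ∈ Sᶜ} => i.val)).rank
  set K := (univ.filter fun x : Fin n → ZMod 2 => H.mulVec x = 0 ∧ A x = 0).card
  have cK : (K : ℝ) * 2 ^ ρ * 2 ^ S.card = 2 ^ n := by
    have h : K * 2 ^ ρ = 2 ^ Fintype.card {i // i ∈ Sᶜ} := by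
      rw [← card_mulVec_eq_zero_mul_two_pow_rank
        (H.submatrix id (fun i : {i : Fin n // i ∈ Sᶜ} => i.val))]
      congr 1
      convert card_mulVec_eq_zero_of_restrict_eq_zero H S
      rfl
    have h' : K * 2 ^ ρ * 2 ^ S.card = 2 ^ n := by
      have hc : Fintype.card {i // i ∈ Sᶜ} + S.card = n := by
        rw [Fintype.card_coe, Finset.card_compl_add_card, Fintype.card_fin]
      rw [h, ← pow_add, hc]
    exact_mod_cast h'
  have cN : ∀ m z, (univ.filter fun x : Fin n → ZMod 2 => H.mulVec x = m ∧ A x = z).card = 0 ∨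
      (univ.filter fun x : Fin n → ZMod 2 => H.mulVec x = m ∧ A x = z).card = K := by
    intro m z
    by_cases h : (m, z) ∈ Set.range (H.mulVecLin.toAddMonoidHom.prod A)
    · right
      have := AddMonoidHom.card_fiber_eq_of_mem_range (H.mulVecLin.toAddMonoidHom.prod A) h
        (y := 0) ⟨0, map_zero _⟩
      simpa [Prod.ext_iff] using this
    · left
      rw [Finset.card_eq_zero, Finset.filter_eq_empty_iff]
      rintro x - ⟨h1, h2⟩
      exact h ⟨x, Prod.ext h1 h2⟩
  have hP : ∀ (m : Fin a → ZMod 2) (z : {i : Fin n // i ∈ S} → ZMod 2), (1 : ℝ) / 2 ^ a *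
      (((univ.filter fun x : Fin n → ZMod 2 => H.mulVec x = m ∧
          (fun i : {i : Fin n // i ∈ S} => x i.val) = z).card : ℝ) /
        ((univ.filter fun x : Fin n → ZMod 2 => H.mulVec x = m).card : ℝ))
      = ((univ.filter fun x : Fin n → ZMod 2 => H.mulVec x = m ∧ A x = z).card : ℝ) / 2 ^ n := by
    intro m z
    rw [← cL m, div_mul_div_comm, one_mul, mul_comm (2 ^ a : ℝ)]
    rfl
  simp only [hP]
  have hz : ∀ z, ∑ m, ((univ.filter fun x : Fin n → ZMod 2 => H.mulVec x = m ∧ A x = z).card : ℝ)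
      / 2 ^ n = 1 / 2 ^ S.card := by
    intro z
    have h := Finset.card_eq_sum_card_fiberwise (f := H.mulVec)
      (s := univ.filter fun x => A x = z) (t := univ) (by simp)
    simp only [Finset.filter_filter, and_comm (a := A _ = z)] at h
    rw [← Finset.sum_div, ← Nat.cast_sum, ← h, ← cA z]
    have : ((univ.filter fun x => A x = z).card : ℝ) ≠ 0 := by
      intro h0
      have := cA z
      rw [h0, zero_mul] at this
      exact (pow_ne_zero n two_ne_zero) this.symm
    field_simp
  rw [condEnt_eq_neg_logb _ (K / 2 ^ n) (1 / 2 ^ S.card) _ hz]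
  · have hK0 : (K : ℝ) ≠ 0 := by
      intro h0
      rw [h0, zero_mul, zero_mul] at cK
      exact (pow_ne_zero n two_ne_zero) cK.symm
    have : (K : ℝ) / 2 ^ n / (1 / 2 ^ S.card) = (2 ^ ρ)⁻¹ := by
      rw [← cK]
      field_simp
    rw [this, Real.logb_inv, neg_neg, Real.logb_pow, Real.logb_self_eq_one one_lt_two, mul_one]
  · rw [Finset.sum_comm]
    simp only [hz, Finset.sum_const, Finset.card_univ, Fintype.card_fun, ZMod.card,
      Fintype.card_coe, nsmul_eq_mul]
    push_cast
    field_simp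
  · intro m z
    rcases cN m z with h | h <;> simp [h]

/-- Lemma 4 of Ozarow and Wyner: for the linear coset coding scheme with full-rank
parity check matrix `H` (message `M` uniform, transmitted word `X` uniform on
`{x : x·Hᵀ = m}` given `M = m`, observation `Z = X|_S`), the adversary's equivocation
satisfies `min_{|S| = rn} H(M|Z) = min_{|I| = (1−r)n} rank(H(I))`. -/
theorem coset_coding_equivocation_eq_min_rank
    (n : ℕ) (hn : 0 < n) (R r : ℝ) (hR0 : 0 < R) (hR1 : R < 1) (hr0 : 0 < r) (hr1 : r < 1)
    (a s : ℕ) (ha : (a : ℝ) = R * n) (hs : (s : ℝ) = r * n)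
    (H : Matrix (Fin a) (Fin n) (ZMod 2)) (hrank : H.rank = a) :
    sInf { h : ℝ | ∃ S : Finset (Fin n), S.card = s ∧
        h = condEnt (fun (m : Fin a → ZMod 2) (z : {i : Fin n // i ∈ S} → ZMod 2) =>
          ((1 : ℝ) / (2 : ℝ) ^ a) *
            (((Finset.univ.filter (fun x : Fin n → ZMod 2 =>
                Matrix.vecMul x H.transpose = m ∧
                  (fun i : {i : Fin n // i ∈ S} => x i.val) = z)).card : ℝ)
              / ((Finset.univ.filter (fun x : Fin n → ZMod 2 =>
                  Matrix.vecMul x H.transpose = m)).card : ℝ))) }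
    = sInf { ρ : ℝ | ∃ I : Finset (Fin n), I.card = n - s ∧
        ρ = ((H.submatrix id (fun i : {i : Fin n // i ∈ I} => i.val)).rank : ℝ) } := by
  have hsn : s ≤ n := by
    have hle : (s : ℝ) ≤ n := by
      rw [hs]
      exact mul_le_of_le_one_left n.cast_nonneg hr1.le
    exact_mod_cast hle
  simp only [condEnt_coset_coding_eq_rank H hrank]
  congr 1
  ext h
  constructor
  · rintro ⟨S, hS, rfl⟩
    exact ⟨Sᶜ, by rw [Finset.card_compl, Fintype.card_fin, hS], rfl⟩
  · rintro ⟨I, hI, rfl⟩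
    refine ⟨Iᶜ, by rw [Finset.card_compl, Fintype.card_fin, hI]; omega, ?_⟩
    rw [compl_compl]
end
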